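/- arXiv:1603.01172 — 13 statements merged into one kernel-verified Lean document; each statement's English description precedes it below -/
import Mathlib

section
/- For every ε > 0, ϑ ∈ ℝ, t > 0, d ≥ 1, the function K : ℝ^d → ℝ defined by K(x) = (2π)^{-d} ∫_{ℝ^d} exp(-(εt/8)·(-2ϑ + |ξ|²)²) · cos(⟨ξ, x⟩) dξ is integrable on ℝ^d, and for every η ∈ ℝ^d one has ∫_{ℝ^d} K(x) · e^{-i⟨η, x⟩} dx = exp(-(εt/8)·(-2ϑ + |η|²)²). -/
open MeasureTheory Real
open scoped RealInnerProductSpace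

open scoped SchwartzMap FourierTransform ContDiff in
theorem lks_aux_schwartz (d : ℕ) (a ϑ : ℝ) (ha : 0 < a) :
    ∃ F : 𝓢(EuclideanSpace ℝ (Fin d), ℂ), ∀ ξ,
      F ξ = ((Real.exp (-a * (-2 * ϑ + ‖ξ‖ ^ 2) ^ 2) : ℝ) : ℂ) := by
  let q : EuclideanSpace ℝ (Fin d) → ℝ := fun ξ => -a * (-2 * ϑ + ‖ξ‖ ^ 2) ^ 2
  have hq : q.HasTemperateGrowth := by
    have h := Function.hasTemperateGrowth_norm_sq (H := EuclideanSpace ℝ (Fin d))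
    exact (Function.HasTemperateGrowth.const _).fun_mul
      (((Function.HasTemperateGrowth.const _).fun_add h).fun_pow 2)
  have hqb : ∀ ξ, q ξ ≤ (5 / 4 + 2 * ϑ + 1 / (4 * a)) - (1 + ‖ξ‖) := by
    intro ξ
    have h1 : 0 ≤ a * ((-2 * ϑ + ‖ξ‖ ^ 2) - 1 / (2 * a)) ^ 2 := by positivity
    have h2 : a * ((-2 * ϑ + ‖ξ‖ ^ 2) - 1 / (2 * a)) ^ 2
        = a * (-2 * ϑ + ‖ξ‖ ^ 2) ^ 2 - (-2 * ϑ + ‖ξ‖ ^ 2) + 1 / (4 * a) := by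
      field_simp
      ring
    simp only [q]
    nlinarith [sq_nonneg (‖ξ‖ - 1 / 2)]
  let f : 𝓢(EuclideanSpace ℝ (Fin d), ℝ) :=
    { toFun := Real.exp ∘ q
      smooth' := Real.contDiff_exp.comp hq.1
      decay' := by
        intro m n
        obtain ⟨k, C, hC, hb⟩ := hq.norm_iteratedFDeriv_le_uniform n
        set B : ℝ := 5 / 4 + 2 * ϑ + 1 / (4 * a)
        refine ⟨n.factorial * (C + 1) ^ n * (Real.exp B * (m + k * n).factorial), fun x => ?_⟩
        have h1x : 1 ≤ 1 + ‖x‖ := by linarith [norm_nonneg x]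
        have key := norm_iteratedFDeriv_comp_le (𝕜 := ℝ) (n := n) (N := ∞) (g := Real.exp) (f := q)
          Real.contDiff_exp hq.1 (by exact_mod_cast le_top) x (C := Real.exp (q x))
          (D := (C + 1) * (1 + ‖x‖) ^ k)
          (fun i _ => by
            rw [norm_iteratedFDeriv_eq_norm_iteratedDeriv, iteratedDeriv_eq_iterate]
            simp)
          (fun i hi hin => by
            have hD : 1 ≤ (C + 1) * (1 + ‖x‖) ^ k :=
              one_le_mul_of_one_le_of_one_le (by linarith) (one_le_pow₀ h1x)
            calc _ ≤ C * (1 + ‖x‖) ^ k := hb i hin x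
              _ ≤ (C + 1) * (1 + ‖x‖) ^ k := by gcongr; linarith
              _ ≤ _ := le_self_pow₀ hD (by omega))
        have hfac : (1 + ‖x‖) ^ (m + k * n) ≤ (m + k * n).factorial * Real.exp (1 + ‖x‖) := by
          have := Real.pow_div_factorial_le_exp (x := 1 + ‖x‖) (by linarith) (m + k * n)
          rwa [div_le_iff₀' (by positivity)] at this
        have hexp : Real.exp (q x) * Real.exp (1 + ‖x‖) ≤ Real.exp B := by
          rw [← Real.exp_add, Real.exp_le_exp]
          linarith [hqb x]
        calc ‖x‖ ^ m * ‖iteratedFDeriv ℝ n (Real.exp ∘ q) x‖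
            ≤ (1 + ‖x‖) ^ m * (n.factorial * Real.exp (q x) * ((C + 1) * (1 + ‖x‖) ^ k) ^ n) := by
              gcongr
              linarith
          _ = n.factorial * (C + 1) ^ n * (Real.exp (q x) * (1 + ‖x‖) ^ (m + k * n)) := by
              rw [mul_pow, ← pow_mul, pow_add]; ring
          _ ≤ n.factorial * (C + 1) ^ n *
                (Real.exp (q x) * ((m + k * n).factorial * Real.exp (1 + ‖x‖))) := by
              gcongr
          _ = n.factorial * (C + 1) ^ n *
                ((Real.exp (q x) * Real.exp (1 + ‖x‖)) * (m + k * n).factorial) := by ring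
          _ ≤ _ := by gcongr }
  exact ⟨f.postcompCLM Complex.ofRealCLM, fun ξ => rfl⟩

open scoped SchwartzMap FourierTransform in
/-- The L-KS kernel `K(x) = (2π)^{-d} ∫ exp(-(εt/8)(-2ϑ+|ξ|²)²) cos⟨ξ,x⟩ dξ` is integrable
and its Fourier transform at `η` equals `exp(-(εt/8)(-2ϑ+|η|²)²)`. -/
theorem lks_kernel_fourier_transform
    (d : ℕ) (hd : 1 ≤ d) (ε ϑ t : ℝ) (hε : 0 < ε) (ht : 0 < t)
    (K : EuclideanSpace ℝ (Fin d) → ℝ)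
    (hK : ∀ x : EuclideanSpace ℝ (Fin d),
      K x = (2 * π) ^ (-(d : ℝ)) *
        ∫ ξ : EuclideanSpace ℝ (Fin d),
          Real.exp (-(ε * t / 8) * (-2 * ϑ + ‖ξ‖ ^ 2) ^ 2) * Real.cos ⟪ξ, x⟫) :
    Integrable K ∧
      ∀ η : EuclideanSpace ℝ (Fin d),
        (∫ x : EuclideanSpace ℝ (Fin d),
            (K x : ℂ) * Complex.exp (-Complex.I * ((⟪η, x⟫ : ℝ) : ℂ)))
          = Complex.exp (-(((ε * t / 8) * (-2 * ϑ + ‖η‖ ^ 2) ^ 2 : ℝ) : ℂ)) := by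
  obtain ⟨F, hF⟩ := lks_aux_schwartz d (ε * t / 8) ϑ (by positivity)
  have h2π : (0:ℝ) < 2 * π := by positivity
  have hG : ∀ y, (𝓕⁻ F) y = ∫ ξ, Complex.exp ((⟪ξ, (2 * π) • y⟫ : ℝ) * Complex.I) * F ξ := by
    intro y
    rw [SchwartzMap.fourierInv_coe, Real.fourierInv_eq']
    simp only [inner_smul_right, smul_eq_mul]
  have hint : ∀ x : EuclideanSpace ℝ (Fin d),
      Integrable (fun ξ => Complex.exp ((⟪ξ, x⟫ : ℝ) * Complex.I) * F ξ) := by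
    intro x
    refine F.integrable.bdd_mul (c := 1) (Continuous.aestronglyMeasurable (by fun_prop)) ?_
    filter_upwards with ξ
    rw [Complex.norm_exp_ofReal_mul_I]
  have hcos : ∀ x : EuclideanSpace ℝ (Fin d),
      ∫ ξ, Complex.exp ((⟪ξ, x⟫ : ℝ) * Complex.I) * F ξ =
      ((∫ ξ : EuclideanSpace ℝ (Fin d),
          Real.exp (-(ε * t / 8) * (-2 * ϑ + ‖ξ‖ ^ 2) ^ 2) * Real.cos ⟪ξ, x⟫ : ℝ) : ℂ) := by
    intro x
    have hneg : ∫ ξ, Complex.exp ((⟪ξ, x⟫ : ℝ) * Complex.I) * F ξ =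
        ∫ ξ, Complex.exp ((⟪-ξ, x⟫ : ℝ) * Complex.I) * F ξ := by
      rw [← integral_neg_eq_self]
      congr 1 with ξ
      rw [hF, hF, norm_neg]
    have hsum : ∫ ξ, Complex.exp ((⟪ξ, x⟫ : ℝ) * Complex.I) * F ξ =
        ∫ ξ, (1 / 2 : ℂ) * (Complex.exp ((⟪ξ, x⟫ : ℝ) * Complex.I) * F ξ +
          Complex.exp ((⟪-ξ, x⟫ : ℝ) * Complex.I) * F ξ) := by
      have hint' : Integrable (fun ξ => Complex.exp ((⟪-ξ, x⟫ : ℝ) * Complex.I) * F ξ) := by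
        simpa only [inner_neg_left, inner_neg_right] using hint (-x)
      rw [integral_const_mul, integral_add (hint x) hint', ← hneg]
      ring
    rw [hsum, ← integral_complex_ofReal]
    congr 1 with ξ
    rw [hF, inner_neg_left, Complex.ofReal_mul, Complex.ofReal_cos, Complex.cos]
    push_cast
    ring
  have hKG : ∀ x, (K x : ℂ) = (((2 * π) ^ d)⁻¹ : ℝ) * (𝓕⁻ F) ((2 * π)⁻¹ • x) := by
    intro x
    rw [hK, hG, smul_smul, mul_inv_cancel₀ h2π.ne', one_smul, hcos, Real.rpow_neg h2π.le,
      Real.rpow_natCast, Complex.ofReal_mul]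
  constructor
  · have h1 : Integrable (fun x => (K x : ℂ)) := by
      simp only [hKG]
      exact ((𝓕⁻ F).integrable.comp_smul (inv_ne_zero h2π.ne')).const_mul _
    exact h1.re
  · intro η
    have h1 : ∀ x, (K x : ℂ) * Complex.exp (-Complex.I * ((⟪η, x⟫ : ℝ) : ℂ)) =
        (((2 * π) ^ d)⁻¹ : ℝ) * (fun y => Complex.exp ((-2 * π * ⟪y, η⟫ : ℝ) * Complex.I) *
          (𝓕⁻ F) y) ((2 * π)⁻¹ • x) := by
      intro x
      have : (-2 * π * ⟪(2 * π)⁻¹ • x, η⟫ : ℝ) = - ⟪η, x⟫ := by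
        rw [real_inner_smul_left, real_inner_comm]
        field_simp
      simp only [this]
      rw [hKG]
      push_cast
      ring_nf
    simp only [h1]
    rw [integral_const_mul, Measure.integral_comp_inv_smul_of_nonneg volume
      (fun y => Complex.exp ((-2 * π * ⟪y, η⟫ : ℝ) * Complex.I) *
        (𝓕⁻ F : 𝓢(EuclideanSpace ℝ (Fin d), ℂ)) y) h2π.le]
    have h2 : ∫ y, Complex.exp ((-2 * π * ⟪y, η⟫ : ℝ) * Complex.I) *
        (𝓕⁻ F : 𝓢(EuclideanSpace ℝ (Fin d), ℂ)) y = F η := by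
      have := congrArg (fun f : 𝓢(EuclideanSpace ℝ (Fin d), ℂ) => f η)
        (FourierTransform.fourier_fourierInv_eq (F := 𝓢(EuclideanSpace ℝ (Fin d), ℂ)) F)
      rw [← this, SchwartzMap.fourier_coe, Real.fourier_eq']
      simp
    rw [h2, hF, finrank_euclideanSpace_fin, Complex.real_smul, ← mul_assoc, ← Complex.ofReal_mul,
      inv_mul_cancel₀ (by positivity)]
    push_cast
    ring_nf
end

section
/- Let 0 < β ≤ 1, x > 0, σ > 0 and τ ∈ ℝ. Then the integral ∫_0^∞ E_β(-x t^β) · e^{-t(σ + iτ)} dt converges absolutely and equals (σ + iτ)^{β-1} / ((σ + iτ)^β + x), where complex powers are taken with the principal branch. -/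
open MeasureTheory Real

/-- The Mittag-Leffler function `E_β(z) = ∑ₖ zᵏ / Γ(1 + βk)`. -/
noncomputable def mittagLeffler (β z : ℝ) : ℝ :=
  ∑' k : ℕ, z ^ k / Real.Gamma (1 + β * k)

lemma ml_gamma_lower (c s : ℝ) (hc : 0 < c) (hs : 0 ≤ s) :
    c ^ s * Real.exp (-c) ≤ Real.Gamma (1 + s) := by
  have h1 : (0:ℝ) < 1 + s := by linarith
  rw [Real.Gamma_eq_integral h1]
  have hint := Real.GammaIntegral_convergent h1
  calc c ^ s * Real.exp (-c) = ∫ t in Set.Ioi c, c ^ s * Real.exp (-t) := by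
        rw [integral_const_mul, integral_exp_neg_Ioi]
    _ ≤ ∫ t in Set.Ioi c, Real.exp (-t) * t ^ (1 + s - 1) := by
        refine setIntegral_mono_on ?_ (hint.mono_set (Set.Ioi_subset_Ioi hc.le)) measurableSet_Ioi ?_
        · exact (integrableOn_exp_neg_Ioi c).const_mul _
        · intro t ht
          rw [mul_comm, add_sub_cancel_left]
          have : c ≤ t := le_of_lt ht
          gcongr
    _ ≤ _ := by
        refine setIntegral_mono_set hint ?_ (LE.le.eventuallyLE (Set.Ioi_subset_Ioi hc.le))
        filter_upwards [ae_restrict_mem measurableSet_Ioi] with t ht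
        have : (0:ℝ) < t := ht
        simp only [Pi.zero_apply]
        positivity

lemma ml_summable (β : ℝ) (hβ : 0 < β) (z : ℝ) :
    Summable (fun k : ℕ => z ^ k / Real.Gamma (1 + β * k)) := by
  set r := |z| + 1 with hr
  have hr0 : 0 < r := by positivity
  set c := (2 * r) ^ (1 / β) with hc
  have hc0 : 0 < c := by positivity
  have hcb : c ^ β = 2 * r := by
    rw [hc, ← Real.rpow_mul (by positivity)]; field_simp; simp
  refine Summable.of_norm_bounded (g := fun k : ℕ => Real.exp c * (1/2:ℝ) ^ k)
    ((summable_geometric_of_lt_one (by norm_num) (by norm_num)).mul_left _) ?_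
  intro k
  have hg := ml_gamma_lower c (β * k) hc0 (by positivity)
  have hg0 : 0 < Real.Gamma (1 + β * k) := Real.Gamma_pos_of_pos (by positivity)
  rw [Real.rpow_mul hc0.le, hcb, Real.rpow_natCast] at hg
  rw [norm_div, norm_pow, Real.norm_eq_abs, Real.norm_of_nonneg hg0.le, div_le_iff₀ hg0]
  calc |z| ^ k ≤ r ^ k := by gcongr; linarith
    _ = Real.exp c * (1/2) ^ k * ((2 * r) ^ k * Real.exp (-c)) := by
        rw [Real.exp_neg, mul_pow]; field_simp; rw [← mul_pow]; norm_num
    _ ≤ _ := by gcongr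

lemma ml_continuous (β : ℝ) (hβ : 0 < β) : Continuous (mittagLeffler β) := by
  rw [continuous_iff_continuousAt]
  intro z
  have : ContinuousOn (mittagLeffler β) (Metric.ball 0 (|z| + 1)) := by
    unfold mittagLeffler
    refine continuousOn_tsum (fun i => by fun_prop) (ml_summable β hβ (|z| + 1)) ?_
    intro k y hy
    have hg0 : 0 < Real.Gamma (1 + β * k) := Real.Gamma_pos_of_pos (by positivity)
    rw [norm_div, norm_pow, Real.norm_of_nonneg hg0.le]
    have : ‖y‖ ≤ |z| + 1 := by simpa using (Metric.mem_ball.1 hy).le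
    gcongr
  exact this.continuousAt (Metric.isOpen_ball.mem_nhds (by simp))

lemma ml_beta (β p : ℝ) (hβ1 : β < 1) (hp : 0 < p) :
    IntervalIntegrable (fun s : ℝ => s ^ (p - 1) * (1 - s) ^ (-β)) volume 0 1 ∧
    ∫ s in (0:ℝ)..1, s ^ (p - 1) * (1 - s) ^ (-β)
      = Real.Gamma p * Real.Gamma (1 - β) / Real.Gamma (p + (1 - β)) := by
  have hcongr : ∀ s : ℝ, s ∈ Set.Icc (0:ℝ) 1 → 
     (s : ℂ) ^ ((p:ℂ) - 1) * (1 - (s : ℂ)) ^ (((1 - β : ℝ) : ℂ) - 1) = ((s ^ (p - 1) * (1 - s) ^ (-β) : ℝ) : ℂ) := by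
    intro s hs
    rw [Complex.ofReal_mul, Complex.ofReal_cpow hs.1, Complex.ofReal_cpow (by linarith [hs.2])]
    push_cast
    congr 2
    ring
  have hc := Complex.betaIntegral_convergent (u := p) (v := ((1 - β : ℝ) : ℂ)) (by simpa) (by rw [Complex.ofReal_re]; linarith)
  have hv := Complex.betaIntegral_eq_Gamma_mul_div p ((1 - β : ℝ) : ℂ) (by simpa) (by rw [Complex.ofReal_re]; linarith)
  constructor
  · rw [intervalIntegrable_iff, Set.uIoc_of_le zero_le_one] at hc ⊢
    have := hc.re
    refine IntegrableOn.congr_fun (f := fun s : ℝ => ((s : ℂ) ^ ((p:ℂ) - 1) * (1 - (s : ℂ)) ^ (((1 - β : ℝ) : ℂ) - 1)).re) this ?_ measurableSet_Ioc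
    intro s hs
    simp only
    rw [hcongr s ⟨hs.1.le, hs.2⟩, Complex.ofReal_re]
  · rw [Complex.betaIntegral] at hv
    rw [intervalIntegral.integral_congr (g := fun s : ℝ => ((s ^ (p - 1) * (1 - s) ^ (-β) : ℝ) : ℂ)), intervalIntegral.integral_ofReal, Complex.Gamma_ofReal, Complex.Gamma_ofReal, ← Complex.ofReal_add, Complex.Gamma_ofReal] at hv
    · exact_mod_cast hv
    · intro s hs
      rw [Set.uIcc_of_le zero_le_one] at hs
      exact hcongr s hs

lemma ml_pow_le (p s : ℝ) (hp : 0 < p) (hs0 : 0 ≤ s) (hs1 : s ≤ 1) :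
    1 - s ^ p ≤ (1 + p) * (1 - s) := by
  rcases le_total p 1 with h | h
  · have : s ≤ s ^ p := by
      simpa using Real.rpow_le_rpow_of_exponent_ge' hs0 hs1 hp.le h
    nlinarith
  · have := one_add_mul_self_le_rpow_one_add (s := s - 1) (by linarith) h
    rw [add_sub_cancel] at this
    nlinarith

lemma ml_kernel (β p : ℝ) (hβ0 : 0 < β) (hβ1 : β < 1) (hp : 0 < p) :
    IntervalIntegrable (fun s : ℝ => β * (1 - s) ^ (-β - 1) * (1 - s ^ p)) volume 0 1 ∧
    ∫ s in (0:ℝ)..1, β * (1 - s) ^ (-β - 1) * (1 - s ^ p)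
      = Real.Gamma (1 + p) * Real.Gamma (1 - β) / Real.Gamma (1 + (p - β)) - 1 := by
  obtain ⟨hb, hbv⟩ := ml_beta β p hβ1 hp
  have hI : IntervalIntegrable (fun s : ℝ => β * (1 - s) ^ (-β - 1) * (1 - s ^ p)) volume 0 1 := by
    have h0 : IntervalIntegrable (fun s : ℝ => β * (1 + p) * (1 - s) ^ (-β)) volume 0 1 := by
      have := (intervalIntegral.intervalIntegrable_rpow' (r := -β) (a := 0) (b := 1) (by linarith)).comp_sub_left 1
      simp only [sub_zero, sub_self] at this
      exact this.symm.const_mul _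
    refine h0.mono_fun' (by fun_prop) ?_
    rw [Set.uIoc_of_le zero_le_one, ← restrict_Ioo_eq_restrict_Ioc]
    filter_upwards [ae_restrict_mem measurableSet_Ioo] with s hs
    have h1 : 0 < 1 - s := by linarith [hs.2]
    have h2 : s ^ p ≤ 1 := Real.rpow_le_one hs.1.le hs.2.le hp.le
    have h3 := ml_pow_le p s hp hs.1.le hs.2.le
    have h4 : 0 ≤ 1 - s ^ p := by linarith
    rw [Real.norm_of_nonneg (by positivity)]
    have h5 : (1 - s) ^ (-β) = (1 - s) ^ (-β - 1) * (1 - s) := by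
      rw [Real.rpow_sub_one h1.ne']; field_simp
    rw [h5]
    calc _ ≤ β * (1 - s) ^ (-β - 1) * ((1 + p) * (1 - s)) := by gcongr
      _ = _ := by ring
  refine ⟨hI, ?_⟩
  have hftc := intervalIntegral.integral_eq_sub_of_hasDerivAt_of_tendsto (a := 0) (b := 1)
    (f := fun s : ℝ => (1 - s) ^ (-β) * (1 - s ^ p)) 
    (f' := fun s : ℝ => β * (1 - s) ^ (-β - 1) * (1 - s ^ p) - p * (s ^ (p - 1) * (1 - s) ^ (-β)))
    (fa := 1) (fb := 0) zero_lt_one ?_ (hI.sub (hb.const_mul p)) ?_ ?_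
  · rw [intervalIntegral.integral_sub hI (hb.const_mul p), intervalIntegral.integral_const_mul, hbv] at hftc
    have hG : Real.Gamma (1 + p) = p * Real.Gamma p := by rw [add_comm, Real.Gamma_add_one hp.ne']
    have : ∫ s in (0:ℝ)..1, β * (1 - s) ^ (-β - 1) * (1 - s ^ p) = p * (Real.Gamma p * Real.Gamma (1 - β) / Real.Gamma (p + (1 - β))) - 1 := by linarith
    rw [this, hG]
    ring_nf
  · intro s hs
    have h1 : 0 < 1 - s := by linarith [hs.2]
    have d1 : HasDerivAt (fun s : ℝ => 1 - s) (-1) s := by simpa using (hasDerivAt_id s).const_sub 1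
    have d2 := d1.rpow_const (p := -β) (Or.inl h1.ne')
    have d3 := ((hasDerivAt_id s).rpow_const (p := p) (Or.inl hs.1.ne')).const_sub 1
    refine (d2.mul d3).congr_deriv ?_
    simp only [id]
    ring
  · have : ContinuousAt (fun s : ℝ => (1 - s) ^ (-β) * (1 - s ^ p)) 0 := by
      refine ContinuousAt.mul (ContinuousAt.rpow_const (by fun_prop) (by simp)) ?_
      exact continuousAt_const.sub (continuousAt_id.rpow_const (Or.inr hp.le))
    have h := this.tendsto
    simp only [sub_zero, Real.one_rpow, Real.zero_rpow hp.ne', mul_one] at h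
    exact h.mono_left nhdsWithin_le_nhds
  · have hz : Filter.Tendsto (fun s : ℝ => (1 + p) * (1 - s) ^ (1 - β)) (nhdsWithin 1 (Set.Iio 1)) (nhds 0) := by
      have : ContinuousAt (fun s : ℝ => (1 + p) * (1 - s) ^ (1 - β)) 1 := 
        continuousAt_const.mul (ContinuousAt.rpow_const (by fun_prop) (Or.inr (by linarith)))
      have h := this.tendsto
      simp only [sub_self, Real.zero_rpow (by linarith : 1 - β ≠ 0), mul_zero] at h
      exact h.mono_left nhdsWithin_le_nhds
    refine tendsto_of_tendsto_of_tendsto_of_le_of_le' tendsto_const_nhds hz ?_ ?_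
    all_goals
      filter_upwards [Ioo_mem_nhdsLT (zero_lt_one' ℝ)] with s hs
      have h1 : 0 < 1 - s := by linarith [hs.2]
      have h2 : s ^ p ≤ 1 := Real.rpow_le_one hs.1.le hs.2.le hp.le
      have h3 := ml_pow_le p s hp hs.1.le hs.2.le
      have h4 : 0 ≤ 1 - s ^ p := by linarith
    · positivity
    · have h5 : (1 - s) ^ (1 - β) = (1 - s) ^ (-β) * (1 - s) := by
        rw [← Real.rpow_add_one h1.ne']; congr 1; ring
      rw [h5]
      calc _ ≤ (1 - s) ^ (-β) * ((1 + p) * (1 - s)) := by gcongr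
        _ = _ := by ring

lemma ml_identity (β y : ℝ) (hβ0 : 0 < β) (hβ1 : β < 1) (hy : 0 ≤ y) :
    ∫ s in Set.Ioc (0:ℝ) 1, β * (1 - s) ^ (-β - 1) *
      (mittagLeffler β (-y) - mittagLeffler β (-(y * s ^ β)))
      = 1 - (y * Real.Gamma (1 - β) + 1) * mittagLeffler β (-y) := by
  let a : ℕ → ℝ := fun k => (-y) ^ k / Real.Gamma (1 + β * k)
  let F : ℕ → ℝ → ℝ := fun k s =>
    a (k + 1) * (β * (1 - s) ^ (-β - 1) * (1 - s ^ (β * ((k + 1 : ℕ) : ℝ))))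
  let J : ℕ → ℝ := fun k => Real.Gamma (1 + β * ((k + 1 : ℕ) : ℝ)) * Real.Gamma (1 - β) /
    Real.Gamma (1 + β * k) - 1
  have hp : ∀ k : ℕ, 0 < β * ((k + 1 : ℕ) : ℝ) := fun k => by positivity
  have hK : ∀ k : ℕ, IntegrableOn (fun s : ℝ => β * (1 - s) ^ (-β - 1) * (1 - s ^ (β * ((k + 1 : ℕ) : ℝ)))) (Set.Ioc 0 1) ∧
      ∫ s in Set.Ioc (0:ℝ) 1, β * (1 - s) ^ (-β - 1) * (1 - s ^ (β * ((k + 1 : ℕ) : ℝ))) = J k := by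
    intro k
    obtain ⟨h1, h2⟩ := ml_kernel β _ hβ0 hβ1 (hp k)
    rw [intervalIntegrable_iff, Set.uIoc_of_le zero_le_one] at h1
    rw [intervalIntegral.integral_of_le zero_le_one] at h2
    refine ⟨h1, h2.trans ?_⟩
    have : β * ((k + 1 : ℕ) : ℝ) - β = β * k := by push_cast; ring
    simp only [J, this]
  have hFi : ∀ k, Integrable (F k) (volume.restrict (Set.Ioc 0 1)) := fun k => (hK k).1.const_mul _
  have hFv : ∀ k, ∫ s in Set.Ioc (0:ℝ) 1, F k s = a (k + 1) * J k := fun k => by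
    simp only [F]; rw [integral_const_mul, (hK k).2]
  have hFn : ∀ k, ∫ s in Set.Ioc (0:ℝ) 1, ‖F k s‖ = |a (k + 1)| * J k := fun k => by
    rw [← (hK k).2, ← integral_const_mul]
    refine setIntegral_congr_fun measurableSet_Ioc ?_
    intro s hs
    simp only [F]
    have h1 : 0 ≤ 1 - s := by linarith [hs.2]
    have h2 : s ^ (β * ((k + 1 : ℕ) : ℝ)) ≤ 1 := Real.rpow_le_one hs.1.le hs.2 (hp k).le
    have h4 : 0 ≤ 1 - s ^ (β * ((k + 1 : ℕ) : ℝ)) := by linarith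
    rw [norm_mul, Real.norm_eq_abs, Real.norm_of_nonneg]
    exact mul_nonneg (mul_nonneg hβ0.le (Real.rpow_nonneg h1 _)) h4
  have hG : ∀ k : ℕ, 0 < Real.Gamma (1 + β * k) := fun k => Real.Gamma_pos_of_pos (by positivity)
  have haJ : ∀ k, a (k + 1) * J k = (-y) * Real.Gamma (1 - β) * a k - a (k + 1) := by
    intro k
    have h1 := (hG k).ne'
    have h2 := (hG (k + 1)).ne'
    simp only [a, J]
    field_simp
    ring
  have hsa : Summable a := ml_summable β hβ0 (-y)
  have hsa1 : Summable (fun k => a (k + 1)) := (summable_nat_add_iff 1).2 hsa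
  have hsJ : Summable (fun k => a (k + 1) * J k) := by
    simp only [haJ]
    exact (hsa.mul_left _).sub hsa1
  have hJ0 : ∀ k, 0 ≤ J k := by
    intro k
    rw [← (hK k).2]
    refine setIntegral_nonneg measurableSet_Ioc ?_
    intro s hs
    have h1 : 0 ≤ 1 - s := by linarith [hs.2]
    have h2 : s ^ (β * ((k + 1 : ℕ) : ℝ)) ≤ 1 := Real.rpow_le_one hs.1.le hs.2 (hp k).le
    have h4 : 0 ≤ 1 - s ^ (β * ((k + 1 : ℕ) : ℝ)) := by linarith
    exact mul_nonneg (mul_nonneg hβ0.le (Real.rpow_nonneg h1 _)) h4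
  have hsn : Summable (fun k => ∫ s in Set.Ioc (0:ℝ) 1, ‖F k s‖) := by
    refine hsJ.abs.congr fun k => ?_
    rw [hFn, abs_mul, abs_of_nonneg (hJ0 k)]
  have hmain := hasSum_integral_of_summable_integral_norm hFi hsn
  have ha0 : a 0 = 1 := by simp [a]
  have hφ : mittagLeffler β (-y) = ∑' k, a k := rfl
  have hφ1 : ∑' k, a (k + 1) = mittagLeffler β (-y) - 1 := by
    have := hsa.tsum_eq_zero_add
    rw [hφ]; linarith
  have hval : ∑' k, (a (k + 1) * J k) = 1 - (y * Real.Gamma (1 - β) + 1) * mittagLeffler β (-y) := by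
    simp only [haJ]
    rw [(hsa.mul_left _).tsum_sub hsa1, tsum_mul_left, hφ1, ← hφ]
    ring
  rw [← hval]
  simp only [hFv] at hmain
  rw [hmain.tsum_eq]
  refine setIntegral_congr_fun measurableSet_Ioc ?_
  intro s hs
  simp only [F]
  have hs1 : HasSum (fun k => a k * s ^ (β * (k:ℝ))) (mittagLeffler β (-(y * s ^ β))) := by
    have := (ml_summable β hβ0 (-(y * s ^ β))).hasSum
    refine this.congr_fun ?_
    intro k
    simp only [a]
    rw [Real.rpow_mul hs.1.le, Real.rpow_natCast, ← neg_mul, mul_pow]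
    ring
  have hs2 : HasSum (fun k => a k * (1 - s ^ (β * (k:ℝ)))) (mittagLeffler β (-y) - mittagLeffler β (-(y * s ^ β))) := by
    refine (hsa.hasSum.sub hs1).congr_fun fun k => ?_
    ring
  have hs3 := (hasSum_nat_add_iff' 1).2 hs2
  simp only [Finset.sum_range_one, Nat.cast_zero, mul_zero, Real.rpow_zero, sub_self, sub_zero] at hs3
  rw [← (hs3.mul_left (β * (1 - s) ^ (-β - 1))).tsum_eq]
  congr 1
  ext k
  ring

lemma ml_le_one_aux (β y : ℝ) (hβ0 : 0 < β) (hβ1 : β < 1) (hy : 0 ≤ y)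
    (h : ∀ w, 0 ≤ w → w ≤ y → mittagLeffler β (-w) ≤ mittagLeffler β (-y)) :
    mittagLeffler β (-y) ≤ 1 := by
  have hid := ml_identity β y hβ0 hβ1 hy
  have h0 : 0 ≤ ∫ s in Set.Ioc (0:ℝ) 1, β * (1 - s) ^ (-β - 1) *
      (mittagLeffler β (-y) - mittagLeffler β (-(y * s ^ β))) := by
    refine setIntegral_nonneg measurableSet_Ioc ?_
    intro s hs
    have h1 : 0 ≤ 1 - s := by linarith [hs.2]
    have h2 : s ^ β ≤ 1 := Real.rpow_le_one hs.1.le hs.2 hβ0.le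
    have h3 : 0 ≤ s ^ β := Real.rpow_nonneg hs.1.le _
    have := h (y * s ^ β) (by positivity) (by nlinarith)
    exact mul_nonneg (mul_nonneg hβ0.le (Real.rpow_nonneg h1 _)) (by linarith)
  have hG : 0 < Real.Gamma (1 - β) := Real.Gamma_pos_of_pos (by linarith)
  by_contra hc
  push Not at hc
  have : 0 ≤ y * Real.Gamma (1 - β) := by positivity
  nlinarith

lemma ml_nonneg_aux (β y : ℝ) (hβ0 : 0 < β) (hβ1 : β < 1) (hy : 0 ≤ y)
    (h : ∀ w, 0 ≤ w → w ≤ y → mittagLeffler β (-y) ≤ mittagLeffler β (-w)) :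
    0 ≤ mittagLeffler β (-y) := by
  have hid := ml_identity β y hβ0 hβ1 hy
  have h0 : ∫ s in Set.Ioc (0:ℝ) 1, β * (1 - s) ^ (-β - 1) *
      (mittagLeffler β (-y) - mittagLeffler β (-(y * s ^ β))) ≤ 0 := by
    refine setIntegral_nonpos measurableSet_Ioc ?_
    intro s hs
    have h1 : 0 ≤ 1 - s := by linarith [hs.2]
    have h2 : s ^ β ≤ 1 := Real.rpow_le_one hs.1.le hs.2 hβ0.le
    have h3 : 0 ≤ s ^ β := Real.rpow_nonneg hs.1.le _
    have := h (y * s ^ β) (by positivity) (by nlinarith)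
    exact mul_nonpos_of_nonneg_of_nonpos (mul_nonneg hβ0.le (Real.rpow_nonneg h1 _)) (by linarith)
  have hG : 0 < Real.Gamma (1 - β) := Real.Gamma_pos_of_pos (by linarith)
  by_contra hc
  push Not at hc
  have : 0 ≤ y * Real.Gamma (1 - β) := by positivity
  nlinarith

lemma ml_bound (β y : ℝ) (hβ0 : 0 < β) (hβ1 : β ≤ 1) (hy : 0 ≤ y) :
    |mittagLeffler β (-y)| ≤ 1 := by
  rcases hβ1.lt_or_eq with hβ1 | rfl
  · have hc : ContinuousOn (fun w => mittagLeffler β (-w)) (Set.Icc 0 y) :=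
      ((ml_continuous β hβ0).comp continuous_neg).continuousOn
    obtain ⟨M, hM, hM'⟩ := isCompact_Icc.exists_isMaxOn (Set.nonempty_Icc.2 hy) hc
    obtain ⟨m, hm, hm'⟩ := isCompact_Icc.exists_isMinOn (Set.nonempty_Icc.2 hy) hc
    have h1 := ml_le_one_aux β M hβ0 hβ1 hM.1 fun w hw hw' => hM' ⟨hw, hw'.trans hM.2⟩
    have h2 := ml_nonneg_aux β m hβ0 hβ1 hm.1 fun w hw hw' => hm' ⟨hw, hw'.trans hm.2⟩
    have h3 : mittagLeffler β (-y) ≤ mittagLeffler β (-M) := hM' ⟨hy, le_rfl⟩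
    have h4 : mittagLeffler β (-m) ≤ mittagLeffler β (-y) := hm' ⟨hy, le_rfl⟩
    rw [abs_le]; constructor <;> linarith
  · have : mittagLeffler 1 (-y) = Real.exp (-y) := by
      rw [mittagLeffler, Real.exp_eq_exp_ℝ, NormedSpace.exp_eq_tsum_div]
      congr 1
      ext k
      rw [one_mul, add_comm, Real.Gamma_nat_eq_factorial]
    rw [this, abs_of_pos (Real.exp_pos _)]
    exact Real.exp_le_one_iff.2 (by linarith)

lemma ml_real_laplace (β x s : ℝ) (hβ0 : 0 < β) (hx : 0 < x) (hs : 0 < s) (hsx : x < s ^ β) :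
    ∫ t in Set.Ioi (0 : ℝ), mittagLeffler β (-x * t ^ β) * Real.exp (-(s * t))
      = s ^ (β - 1) / (s ^ β + x) := by
  let F : ℕ → ℝ → ℝ := fun k t => ((-x) ^ k / Real.Gamma (1 + β * k)) *
    (t ^ ((1 + β * k) - 1) * Real.exp (-(s * t)))
  have hG : ∀ k : ℕ, 0 < Real.Gamma (1 + β * k) := fun k => Real.Gamma_pos_of_pos (by positivity)
  have hpos : ∀ k : ℕ, 0 < 1 + β * k := fun k => by positivity
  have hsβ : 0 < s ^ β := by positivity
  have hI : ∀ k : ℕ, IntegrableOn (fun t : ℝ => t ^ ((1 + β * k) - 1) * Real.exp (-(s * t))) (Set.Ioi 0) := by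
    intro k
    have := integrableOn_rpow_mul_exp_neg_mul_rpow (p := 1) (s := (1 + β * k) - 1) (b := s)
      (by have := hpos k; linarith) zero_lt_one hs
    simpa using this
  have hV : ∀ k : ℕ, ∫ t in Set.Ioi (0:ℝ), t ^ ((1 + β * k) - 1) * Real.exp (-(s * t)) =
      s⁻¹ * (s ^ β)⁻¹ ^ k * Real.Gamma (1 + β * k) := by
    intro k
    rw [Real.integral_rpow_mul_exp_neg_mul_Ioi (hpos k) hs, one_div, Real.rpow_add (by positivity),
      Real.rpow_one, Real.rpow_mul (by positivity), Real.rpow_natCast, Real.inv_rpow hs.le]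
  have hFi : ∀ k, Integrable (F k) (volume.restrict (Set.Ioi 0)) := fun k => (hI k).const_mul _
  have hFv : ∀ k, ∫ t in Set.Ioi (0:ℝ), F k t = s⁻¹ * (-x * (s ^ β)⁻¹) ^ k := fun k => by
    have := (hG k).ne'
    simp only [F]; rw [integral_const_mul, hV, mul_pow]
    field_simp
  have hFn : ∀ k, ∫ t in Set.Ioi (0:ℝ), ‖F k t‖ = s⁻¹ * (x * (s ^ β)⁻¹) ^ k := fun k => by
    have := (hG k).ne'
    have e : ∫ t in Set.Ioi (0:ℝ), ‖F k t‖ = ∫ t in Set.Ioi (0:ℝ), (x ^ k / Real.Gamma (1 + β * k)) *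
        (t ^ ((1 + β * k) - 1) * Real.exp (-(s * t))) := by
      refine setIntegral_congr_fun measurableSet_Ioi ?_
      intro t ht
      have ht : 0 < t := ht
      simp only [F]
      rw [norm_mul, norm_div, norm_pow, norm_neg, Real.norm_of_nonneg hx.le, Real.norm_of_nonneg (hG k).le,
        Real.norm_of_nonneg (by positivity)]
    rw [e, integral_const_mul, hV, mul_pow]
    field_simp
  have hq : x * (s ^ β)⁻¹ < 1 := by
    rw [← div_eq_mul_inv, div_lt_one hsβ]; exact hsx
  have hsn : Summable (fun k => ∫ t in Set.Ioi (0:ℝ), ‖F k t‖) := by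
    simp only [hFn]
    exact (summable_geometric_of_lt_one (by positivity) hq).mul_left _
  have hmain := hasSum_integral_of_summable_integral_norm hFi hsn
  simp only [hFv] at hmain
  have hgeo : HasSum (fun k : ℕ => s⁻¹ * (-x * (s ^ β)⁻¹) ^ k) (s⁻¹ * (1 - -x * (s ^ β)⁻¹)⁻¹) := by
    refine (hasSum_geometric_of_abs_lt_one ?_).mul_left _
    rw [neg_mul, abs_neg, abs_of_pos (by positivity)]; exact hq
  have hv : s⁻¹ * (1 - -x * (s ^ β)⁻¹)⁻¹ = s ^ (β - 1) / (s ^ β + x) := by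
    rw [Real.rpow_sub_one hs.ne']
    have : 1 - -x * (s ^ β)⁻¹ = (s ^ β + x) / s ^ β := by field_simp; ring
    rw [this]
    field_simp
  rw [← hv, hgeo.unique hmain]
  refine setIntegral_congr_fun measurableSet_Ioi ?_
  intro t ht
  have ht : 0 < t := ht
  simp only [F]
  rw [mittagLeffler, ← tsum_mul_right]
  congr 1
  ext k
  rw [add_sub_cancel_left, Real.rpow_mul ht.le, Real.rpow_natCast, mul_pow]
  ring

lemma ml_meas (β x : ℝ) (hβ0 : 0 < β) : Continuous (fun t : ℝ => mittagLeffler β (-x * t ^ β)) :=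
  (ml_continuous β hβ0).comp (continuous_const.mul (Real.continuous_rpow_const hβ0.le))

lemma ml_integrable (β x : ℝ) (hβ0 : 0 < β) (hβ1 : β ≤ 1) (hx : 0 < x) (z : ℂ) (hz : 0 < z.re) :
    IntegrableOn (fun t : ℝ => (mittagLeffler β (-x * t ^ β) : ℂ) * Complex.exp (-(t : ℂ) * z))
      (Set.Ioi 0) := by
  refine Integrable.mono' (g := fun t : ℝ => Real.exp (-z.re * t)) (exp_neg_integrableOn_Ioi 0 hz) ?_ ?_
  · have := ml_meas β x hβ0
    exact Continuous.aestronglyMeasurable (by fun_prop)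
  · filter_upwards [ae_restrict_mem measurableSet_Ioi] with t ht
    have ht : 0 < t := ht
    have h := ml_bound β (x * t ^ β) hβ0 hβ1 (by positivity)
    rw [← neg_mul] at h
    rw [norm_mul, Complex.norm_real, Real.norm_eq_abs, Complex.norm_exp]
    have : (-(t:ℂ) * z).re = -z.re * t := by simp; ring
    rw [this]
    exact mul_le_of_le_one_left (Real.exp_pos _).le h

lemma ml_diff (β x : ℝ) (hβ0 : 0 < β) (hβ1 : β ≤ 1) (hx : 0 < x) :
    DifferentiableOn ℂ (fun z : ℂ => ∫ t in Set.Ioi (0 : ℝ),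
      (mittagLeffler β (-x * t ^ β) : ℂ) * Complex.exp (-(t : ℂ) * z)) {z : ℂ | 0 < z.re} := by
  intro z hz
  have hz : 0 < z.re := hz
  have hm := ml_meas β x hβ0
  refine DifferentiableAt.differentiableWithinAt ?_
  refine (hasDerivAt_integral_of_dominated_loc_of_deriv_le
    (F := fun (z : ℂ) (t : ℝ) => (mittagLeffler β (-x * t ^ β) : ℂ) * Complex.exp (-(t : ℂ) * z))
    (F' := fun (z : ℂ) (t : ℝ) => (mittagLeffler β (-x * t ^ β) : ℂ) *
      (Complex.exp (-(t : ℂ) * z) * (-(t:ℂ))))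
    (s := {w : ℂ | z.re / 2 < w.re}) (bound := fun t : ℝ => t * Real.exp (-(z.re / 2) * t))
    ?_ ?_ (ml_integrable β x hβ0 hβ1 hx z hz) ?_ ?_ ?_ ?_).2.differentiableAt
  · exact (isOpen_lt continuous_const Complex.continuous_re).mem_nhds (by simp; linarith)
  · exact Filter.Eventually.of_forall fun w => Continuous.aestronglyMeasurable (by fun_prop)
  · exact Continuous.aestronglyMeasurable (by fun_prop)
  · filter_upwards [ae_restrict_mem measurableSet_Ioi] with t ht w hw
    have ht : 0 < t := ht
    have hw : z.re / 2 < w.re := hw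
    have h := ml_bound β (x * t ^ β) hβ0 hβ1 (by positivity)
    rw [← neg_mul] at h
    rw [norm_mul, Complex.norm_real, Real.norm_eq_abs, norm_mul, Complex.norm_exp, norm_neg, Complex.norm_real,
      Real.norm_of_nonneg ht.le]
    have : (-(t:ℂ) * w).re = -w.re * t := by simp; ring
    rw [this, mul_comm t]
    refine (mul_le_of_le_one_left (by positivity) h).trans ?_
    gcongr
  · have := integrableOn_rpow_mul_exp_neg_mul_rpow (p := 1) (s := 1) (b := z.re / 2)
      (by norm_num) zero_lt_one (by linarith)
    simpa [IntegrableOn] using this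
  · filter_upwards with t w hw
    have h1 : HasDerivAt (fun w : ℂ => -(t:ℂ) * w) (-(t:ℂ)) w := by
      simpa using (hasDerivAt_id w).const_mul (-(t:ℂ))
    exact h1.cexp.const_mul _

lemma ml_denom (β x : ℝ) (hβ0 : 0 < β) (hβ1 : β ≤ 1) (hx : 0 < x) (z : ℂ) (hz : 0 < z.re) :
    z ^ (β : ℂ) + (x : ℂ) ≠ 0 := by
  have hz0 : z ≠ 0 := by rintro rfl; simp at hz
  have harg : |z.arg| < π / 2 := Complex.abs_arg_lt_pi_div_two_iff.2 (Or.inl hz)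
  have hre : 0 < (z ^ (β : ℂ)).re := by
    rw [Complex.cpow_def_of_ne_zero hz0, Complex.exp_re]
    have him : (Complex.log z * (β:ℂ)).im = z.arg * β := by simp [Complex.log_im]
    rw [him]
    refine mul_pos (Real.exp_pos _) (Real.cos_pos_of_mem_Ioo ?_)
    rw [abs_lt] at harg
    have := Real.pi_pos
    constructor <;> nlinarith
  intro h
  have := congrArg Complex.re h
  simp at this
  linarith

/-- Fourier–Laplace transform of `t ↦ 1_{t>0} E_β(-x t^β) e^{-tσ}`:
the integral `∫₀^∞ E_β(-x t^β) e^{-t(σ+iτ)} dt` converges absolutely and equals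
`(σ+iτ)^{β-1} / ((σ+iτ)^β + x)` (principal branch powers). -/
theorem mittagLeffler_laplace_fourier_transform
    (β x σ τ : ℝ) (hβ0 : 0 < β) (hβ1 : β ≤ 1) (hx : 0 < x) (hσ : 0 < σ) :
    IntegrableOn
      (fun t : ℝ => (mittagLeffler β (-x * t ^ β) : ℂ) *
        Complex.exp (-(t : ℂ) * ((σ : ℂ) + (τ : ℂ) * Complex.I)))
      (Set.Ioi 0) ∧
    (∫ t in Set.Ioi (0 : ℝ), (mittagLeffler β (-x * t ^ β) : ℂ) *
        Complex.exp (-(t : ℂ) * ((σ : ℂ) + (τ : ℂ) * Complex.I)))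
      = ((σ : ℂ) + (τ : ℂ) * Complex.I) ^ ((β : ℂ) - 1) /
          (((σ : ℂ) + (τ : ℂ) * Complex.I) ^ (β : ℂ) + (x : ℂ)) := by
  have hre : 0 < ((σ : ℂ) + (τ : ℂ) * Complex.I).re := by simpa using hσ
  refine ⟨ml_integrable β x hβ0 hβ1 hx _ hre, ?_⟩
  have hopen : IsOpen {z : ℂ | 0 < z.re} := isOpen_lt continuous_const Complex.continuous_re
  have hconn : IsPreconnected {z : ℂ | 0 < z.re} := (convex_halfSpace_re_gt 0).isPreconnected
  have hA := (ml_diff β x hβ0 hβ1 hx).analyticOnNhd hopen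
  have hB : AnalyticOnNhd ℂ (fun z : ℂ => z ^ ((β : ℂ) - 1) / (z ^ (β : ℂ) + (x : ℂ))) {z : ℂ | 0 < z.re} := by
    refine DifferentiableOn.analyticOnNhd (fun z hz => ?_) hopen
    have hz : 0 < z.re := hz
    have hsl : z ∈ Complex.slitPlane := Or.inl hz
    refine DifferentiableAt.differentiableWithinAt ?_
    refine DifferentiableAt.div ?_ ?_ (ml_denom β x hβ0 hβ1 hx z hz)
    · exact differentiableAt_id.cpow_const hsl
    · exact (differentiableAt_id.cpow_const hsl).add_const _
  have hreal : ∀ s : ℝ, 0 < s → x < s ^ β →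
      (∫ t in Set.Ioi (0 : ℝ), (mittagLeffler β (-x * t ^ β) : ℂ) * Complex.exp (-(t : ℂ) * (s:ℂ)))
      = (s:ℂ) ^ ((β : ℂ) - 1) / ((s:ℂ) ^ (β : ℂ) + (x : ℂ)) := by
    intro s hs hsx
    have h := congrArg (fun r : ℝ => (r : ℂ)) (ml_real_laplace β x s hβ0 hx hs hsx)
    rw [← integral_complex_ofReal] at h
    push_cast at h
    rw [Complex.ofReal_cpow hs.le, Complex.ofReal_cpow hs.le] at h
    push_cast at h
    rw [← h]
    congr 1
    ext t
    congr 2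
    ring
  obtain ⟨s0, hs0, hs0x⟩ : ∃ s : ℝ, 0 < s ∧ x < s ^ β := by
    refine ⟨(x + 1) ^ (1 / β), by positivity, ?_⟩
    rw [← Real.rpow_mul (by positivity)]
    field_simp
    simp
  have hfreq : ∃ᶠ z in nhdsWithin (s0 : ℂ) {(s0:ℂ)}ᶜ,
      (∫ t in Set.Ioi (0 : ℝ), (mittagLeffler β (-x * t ^ β) : ℂ) * Complex.exp (-(t : ℂ) * z))
      = z ^ ((β : ℂ) - 1) / (z ^ (β : ℂ) + (x : ℂ)) := by
    have ht : Filter.Tendsto (fun s : ℝ => (s : ℂ)) (nhdsWithin s0 {s0}ᶜ) (nhdsWithin (s0 : ℂ) {(s0:ℂ)}ᶜ) := by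
      refine tendsto_nhdsWithin_iff.2 ⟨?_, ?_⟩
      · exact (Complex.continuous_ofReal.tendsto s0).mono_left nhdsWithin_le_nhds
      · filter_upwards [self_mem_nhdsWithin] with s hs
        simpa using hs
    refine ht.frequently (Filter.Eventually.frequently ?_)
    have h1 : ∀ᶠ s in nhds s0, 0 < s := lt_mem_nhds hs0
    have h2 : ∀ᶠ s in nhds s0, x < s ^ β :=
      (Real.continuous_rpow_const hβ0.le).continuousAt.eventually (lt_mem_nhds hs0x)
    filter_upwards [nhdsWithin_le_nhds h1, nhdsWithin_le_nhds h2] with s a b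
    exact hreal s a b
  exact hA.eqOn_of_preconnected_of_frequently_eq hB hconn (z₀ := (s0:ℂ)) (by simpa using hs0) hfreq hre
end

section
/- Fix d ∈ {1,2,3}, ε > 0 and ϑ ∈ ℝ, and for τ > 0 set Δ(τ) = (2π)^{-d} ∫_{ℝ^d} (τ² + (ε²/64)·(-2ϑ + |ξ|²)⁴)^{-1} dξ. Then lim_{τ → ∞} τ^{2 - d/4} · Δ(τ) = (2π)^{-d} ∫_{ℝ^d} (1 + (ε²/64)·|ξ|⁸)^{-1} dξ, the limit integral being finite and positive; in particular Δ(τ) is asymptotically equivalent, as τ → ∞, to (2π)^{-d} τ^{-(2 - d/4)} ∫_{ℝ^d} (1 + (ε²/64)|ξ|⁸)^{-1} dξ. -/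
open MeasureTheory Real Filter Asymptotics

lemma lks_integrable (d : ℕ) (hd : d < 4) (c : ℝ) (hc : 0 < c) :
    Integrable (fun ξ : EuclideanSpace ℝ (Fin d) => (1 + c * ‖ξ‖ ^ 8)⁻¹) := by
  have h1 : Integrable (fun ξ : EuclideanSpace ℝ (Fin d) => (1 + ‖ξ‖) ^ (-(4:ℝ))) := by
    apply integrable_one_add_norm
    simp only [finrank_euclideanSpace, Fintype.card_fin]
    exact_mod_cast hd
  refine (h1.const_mul (16 * (1 + 1 / c))).mono' ?_ ?_
  · apply Continuous.aestronglyMeasurable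
    apply Continuous.inv₀ (by fun_prop)
    intro x
    positivity
  · refine Eventually.of_forall fun x => ?_
    rw [norm_of_nonneg (by positivity), rpow_neg (by positivity)]
    have hr : (0:ℝ) ≤ ‖x‖ := norm_nonneg x
    generalize ‖x‖ = r at hr
    have e : (1 + r) ^ (4:ℝ) = (1 + r) ^ 4 := by exact_mod_cast rpow_natCast (1 + r) 4
    rw [e, inv_eq_one_div, ← div_eq_mul_inv, div_le_div_iff₀ (by positivity) (by positivity), one_mul]
    have a1 : (1 + r) ^ 2 ≤ 2 * (1 + r ^ 2) := by nlinarith [sq_nonneg (1 - r)]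
    have a2 : (1 + r) ^ 4 ≤ 8 * (1 + r ^ 4) := by
      have : ((1 + r) ^ 2) ^ 2 ≤ (2 * (1 + r ^ 2)) ^ 2 := by gcongr
      nlinarith [sq_nonneg (1 - r ^ 2)]
    have a3 : (1 + r) ^ 4 ≤ 16 * (1 + r ^ 8) := by
      nlinarith [sq_nonneg (1 - r ^ 4), pow_nonneg hr 8]
    have a4 : (1 + 1 / c) * (1 + c * r ^ 8) = 1 + r ^ 8 + (1 / c + c * r ^ 8) := by
      field_simp
      ring
    have : 0 ≤ 1 / c + c * r ^ 8 := by positivity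
    nlinarith

lemma lks_bound (c a y : ℝ) (hc : 0 < c) (ha : |a| ≤ 1) :
    (1 + c * (a + y) ^ 4)⁻¹ ≤ (8 + 8 * c) * (1 + c * y ^ 4)⁻¹ := by
  have p1 : 0 < 1 + c * (a + y) ^ 4 := by positivity
  have p2 : 0 < 1 + c * y ^ 4 := by positivity
  rw [inv_eq_one_div, ← div_eq_mul_inv, div_le_div_iff₀ p1 p2, one_mul]
  have ha2 : a ^ 2 ≤ 1 := by
    rw [← sq_abs]; exact pow_le_one₀ (abs_nonneg a) ha
  have b1 : y ^ 2 ≤ 2 * ((a + y) ^ 2 + 1) := by nlinarith [sq_nonneg (2 * a + y)]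
  have b2 : y ^ 4 ≤ 8 * ((a + y) ^ 4 + 1) := by
    have : (y ^ 2) ^ 2 ≤ (2 * ((a + y) ^ 2 + 1)) ^ 2 := by gcongr
    nlinarith [sq_nonneg ((a + y) ^ 2 - 1)]
  have b3 := mul_le_mul_of_nonneg_left b2 hc.le
  have b4 : 0 ≤ c * (c * (a + y) ^ 4) := by positivity
  nlinarith

lemma lks_scale (d : ℕ) (c ϑ τ : ℝ) (hτ : 0 < τ) :
    τ ^ ((2 : ℝ) - d / 4) *
      ∫ ξ : EuclideanSpace ℝ (Fin d), (τ ^ 2 + c * (-2 * ϑ + ‖ξ‖ ^ 2) ^ 4)⁻¹ =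
    ∫ ξ : EuclideanSpace ℝ (Fin d),
      (1 + c * (-2 * ϑ * τ ^ (-(1/2) : ℝ) + ‖ξ‖ ^ 2) ^ 4)⁻¹ := by
  obtain ⟨s, hs, rfl⟩ : ∃ s : ℝ, 0 < s ∧ τ = s ^ 4 := by
    refine ⟨τ ^ (1 / 4 : ℝ), by positivity, ?_⟩
    rw [← rpow_natCast, ← rpow_mul hτ.le]
    norm_num
  have e1 : (s ^ 4) ^ (-(1/2) : ℝ) = (s ^ 2)⁻¹ := by
    rw [← rpow_natCast, ← rpow_mul hs.le, ← rpow_natCast, ← rpow_neg hs.le]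
    norm_num
  have e2 : (s ^ 4) ^ ((2 : ℝ) - d / 4) = s ^ 8 * (s ^ d)⁻¹ := by
    rw [← rpow_natCast, ← rpow_mul hs.le, ← rpow_natCast, ← rpow_natCast, ← rpow_neg hs.le,
      ← rpow_add hs]
    congr 1
    push_cast
    ring
  have := Measure.integral_comp_smul (volume : Measure (EuclideanSpace ℝ (Fin d)))
    (fun ξ => ((s ^ 4) ^ 2 + c * (-2 * ϑ + ‖ξ‖ ^ 2) ^ 4)⁻¹) s
  rw [finrank_euclideanSpace, Fintype.card_fin, abs_of_pos (by positivity), smul_eq_mul] at this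
  rw [e1, e2, mul_assoc, ← this, ← integral_const_mul]
  congr 1
  ext ξ
  rw [norm_smul, norm_of_nonneg hs.le]
  have : (s ^ 4) ^ 2 + c * (-2 * ϑ + (s * ‖ξ‖) ^ 2) ^ 4 =
      s ^ 8 * (1 + c * (-2 * ϑ * (s ^ 2)⁻¹ + ‖ξ‖ ^ 2) ^ 4) := by
    field_simp
  rw [this, mul_inv, ← mul_assoc, mul_inv_cancel₀ (by positivity), one_mul]

lemma lks_limit (d : ℕ) (hd : d < 4) (c ϑ : ℝ) (hc : 0 < c) :
    Tendsto (fun τ : ℝ => ∫ ξ : EuclideanSpace ℝ (Fin d),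
      (1 + c * (-2 * ϑ * τ ^ (-(1/2) : ℝ) + ‖ξ‖ ^ 2) ^ 4)⁻¹) atTop
      (nhds (∫ ξ : EuclideanSpace ℝ (Fin d), (1 + c * ‖ξ‖ ^ 8)⁻¹)) := by
  have ht : Tendsto (fun τ : ℝ => -2 * ϑ * τ ^ (-(1/2) : ℝ)) atTop (nhds 0) := by
    simpa using (tendsto_rpow_neg_atTop (y := 1/2) (by norm_num)).const_mul (-2 * ϑ)
  have hsmall : ∀ᶠ τ : ℝ in atTop, |-2 * ϑ * τ ^ (-(1/2) : ℝ)| ≤ 1 := by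
    have := ht.abs
    rw [abs_zero] at this
    exact this.eventually_le_const one_pos
  refine tendsto_integral_filter_of_dominated_convergence
    (fun ξ => (8 + 8 * c) * (1 + c * ‖ξ‖ ^ 8)⁻¹) ?_ ?_ ((lks_integrable d hd c hc).const_mul _) ?_
  · refine Eventually.of_forall fun τ => ?_
    apply Continuous.aestronglyMeasurable
    apply Continuous.inv₀ (by fun_prop)
    intro x
    positivity
  · filter_upwards [hsmall] with τ h
    refine Eventually.of_forall fun ξ => ?_
    rw [norm_of_nonneg (by positivity)]
    have := lks_bound c _ (‖ξ‖ ^ 2) hc h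
    rwa [← pow_mul] at this
  · refine Eventually.of_forall fun ξ => ?_
    have h := (((ht.add_const (‖ξ‖ ^ 2)).pow 4).const_mul c).const_add 1
    rw [zero_add, ← pow_mul] at h
    exact h.inv₀ (by positivity)

/-- Asymptotics of the temporal spectral density of the linear L-KS SPDE:
`τ^{2-d/4} Δ(τ) → (2π)^{-d} ∫ (1 + (ε²/64)|ξ|⁸)⁻¹ dξ` as `τ → ∞`, the limit being a
finite positive constant; in particular `Δ(τ) ∼ (2π)^{-d} τ^{-(2-d/4)} ∫ (1+(ε²/64)|ξ|⁸)⁻¹ dξ`. -/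
theorem lks_temporal_spectral_density_asymptotics
    (d : ℕ) (hd : d = 1 ∨ d = 2 ∨ d = 3) (ε ϑ : ℝ) (hε : 0 < ε)
    (Δ : ℝ → ℝ)
    (hΔ : ∀ τ : ℝ, 0 < τ → Δ τ = (2 * π) ^ (-(d : ℝ)) *
      ∫ ξ : EuclideanSpace ℝ (Fin d), (τ ^ 2 + ε ^ 2 / 64 * (-2 * ϑ + ‖ξ‖ ^ 2) ^ 4)⁻¹) :
    Integrable (fun ξ : EuclideanSpace ℝ (Fin d) => (1 + ε ^ 2 / 64 * ‖ξ‖ ^ 8)⁻¹) ∧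
    (0 < ∫ ξ : EuclideanSpace ℝ (Fin d), (1 + ε ^ 2 / 64 * ‖ξ‖ ^ 8)⁻¹) ∧
    Tendsto (fun τ : ℝ => τ ^ ((2 : ℝ) - d / 4) * Δ τ) atTop
      (nhds ((2 * π) ^ (-(d : ℝ)) *
        ∫ ξ : EuclideanSpace ℝ (Fin d), (1 + ε ^ 2 / 64 * ‖ξ‖ ^ 8)⁻¹)) ∧
    (fun τ : ℝ => Δ τ) ~[atTop]
      (fun τ : ℝ => (2 * π) ^ (-(d : ℝ)) * τ ^ (-((2 : ℝ) - d / 4)) *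
        ∫ ξ : EuclideanSpace ℝ (Fin d), (1 + ε ^ 2 / 64 * ‖ξ‖ ^ 8)⁻¹) := by
  have hd4 : d < 4 := by omega
  have hc : 0 < ε ^ 2 / 64 := by positivity
  generalize ε ^ 2 / 64 = c at *
  have hI := lks_integrable d hd4 c hc
  have hpos : 0 < ∫ ξ : EuclideanSpace ℝ (Fin d), (1 + c * ‖ξ‖ ^ 8)⁻¹ := by
    refine integral_pos_of_integrable_nonneg_nonzero (x := 0) ?_ hI ?_ ?_
    · apply Continuous.inv₀ (by fun_prop)
      intro x
      positivity
    · intro x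
      positivity
    · positivity
  have hT : Tendsto (fun τ : ℝ => τ ^ ((2 : ℝ) - d / 4) * Δ τ) atTop
      (nhds ((2 * π) ^ (-(d : ℝ)) *
        ∫ ξ : EuclideanSpace ℝ (Fin d), (1 + c * ‖ξ‖ ^ 8)⁻¹)) := by
    refine ((lks_limit d hd4 c ϑ hc).const_mul ((2 * π) ^ (-(d : ℝ)))).congr' ?_
    filter_upwards [eventually_gt_atTop 0] with τ hτ
    rw [hΔ τ hτ, ← lks_scale d c ϑ τ hτ]
    ring
  refine ⟨hI, hpos, hT, ?_⟩
  have hE := (isEquivalent_const_iff_tendsto (by positivity)).2 hT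
  have hM := (IsEquivalent.refl (u := fun τ : ℝ => τ ^ (-((2 : ℝ) - d / 4)))
    (l := atTop)).mul hE
  refine (hM.congr_left ?_).congr_right ?_
  · filter_upwards [eventually_gt_atTop 0] with τ hτ
    simp only [Pi.mul_apply]
    rw [← mul_assoc, ← rpow_add hτ, neg_add_cancel, rpow_zero, one_mul]
  · refine Eventually.of_forall fun τ => ?_
    simp only [Pi.mul_apply, Function.const_apply]
    ring
end

section
/- For every d ∈ {1,2,3}, ε > 0, ϑ ∈ ℝ and all s, t ≥ 0, ∫_{ℝ^d} ∫_ℝ ( exp(-(ε(t-r)/8)·(-2ϑ+|ξ|²)²)·1_{r<t} − exp(-(ε(s-r)/8)·(-2ϑ+|ξ|²)²)·1_{r<s} )² dr dξ = (1/π) ∫_ℝ (1 − cos((t−s)τ)) · [ ∫_{ℝ^d} (τ² + (ε²/64)·(-2ϑ+|ξ|²)⁴)^{-1} dξ ] dτ, and both sides are finite. -/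
open MeasureTheory Real

lemma lks_lor_int (a : ℝ) (ha : 0 < a) : Integrable (fun τ : ℝ => (τ ^ 2 + a ^ 2)⁻¹) := by
  have h := (integrable_inv_one_add_sq.comp_mul_left' (inv_ne_zero ha.ne')).const_mul ((a ^ 2)⁻¹)
  refine h.congr (Filter.Eventually.of_forall fun τ => ?_)
  have : 0 < τ ^ 2 + a ^ 2 := by positivity
  have h2 : 0 < 1 + (a⁻¹ * τ) ^ 2 := by positivity
  simp only
  rw [← mul_inv]
  congr 1
  field_simp
  ring

lemma lks_exp_abs_int (a : ℝ) (ha : 0 < a) : Integrable (fun x : ℝ => (Real.exp (-a * |x|) : ℂ)) := by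
  suffices h : Integrable (fun x : ℝ => Real.exp (-a * |x|)) from h.ofReal
  rw [← integrableOn_univ, ← Set.Iic_union_Ioi (a := (0:ℝ))]
  apply IntegrableOn.union
  · refine (integrableOn_exp_mul_Iic ha 0).congr_fun (fun x hx => ?_) measurableSet_Iic
    simp [abs_of_nonpos (Set.mem_Iic.1 hx)]
  · refine (integrableOn_exp_mul_Ioi (a := -a) (by linarith) 0).congr_fun (fun x hx => ?_) measurableSet_Ioi
    simp [abs_of_pos (Set.mem_Ioi.1 hx)]

open FourierTransform in
lemma lks_fourier (a : ℝ) (ha : 0 < a) (w : ℝ) :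
    𝓕 (fun x : ℝ => (Real.exp (-a * |x|) : ℂ)) w
      = ((2 * a * ((2 * π * w) ^ 2 + a ^ 2)⁻¹ : ℝ) : ℂ) := by
  rw [fourier_real_eq_integral_exp_smul]
  have hI : Integrable (fun v : ℝ => Complex.exp (↑(-2 * π * v * w) * Complex.I) • (Real.exp (-a * |v|) : ℂ)) := by
    refine (lks_exp_abs_int a ha).bdd_mul (c := 1) ?_ ?_
    · apply Continuous.aestronglyMeasurable; fun_prop
    · exact Filter.Eventually.of_forall fun v => by rw [Complex.norm_exp_ofReal_mul_I]
  rw [← setIntegral_univ, ← Set.Iic_union_Ioi (a := (0:ℝ)),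
    setIntegral_union (Set.Iic_disjoint_Ioi le_rfl) measurableSet_Ioi hI.integrableOn hI.integrableOn]
  have e1 : ∫ v in Set.Iic (0:ℝ), Complex.exp (↑(-2 * π * v * w) * Complex.I) • (Real.exp (-a * |v|) : ℂ)
      = ∫ v in Set.Iic (0:ℝ), Complex.exp ((a - 2 * π * w * Complex.I) * v) := by
    refine setIntegral_congr_fun measurableSet_Iic fun v hv => ?_
    simp only [abs_of_nonpos (Set.mem_Iic.1 hv), smul_eq_mul, Complex.ofReal_exp, ← Complex.exp_add]
    congr 1; push_cast; ring
  have e2 : ∫ v in Set.Ioi (0:ℝ), Complex.exp (↑(-2 * π * v * w) * Complex.I) • (Real.exp (-a * |v|) : ℂ)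
      = ∫ v in Set.Ioi (0:ℝ), Complex.exp ((-a - 2 * π * w * Complex.I) * v) := by
    refine setIntegral_congr_fun measurableSet_Ioi fun v hv => ?_
    simp only [abs_of_pos (Set.mem_Ioi.1 hv), smul_eq_mul, Complex.ofReal_exp, ← Complex.exp_add]
    congr 1; push_cast; ring
  have r1 : 0 < ((a : ℂ) - 2 * π * w * Complex.I).re := by simpa using ha
  have r2 : (-(a : ℂ) - 2 * π * w * Complex.I).re < 0 := by simpa using ha
  rw [e1, e2, integral_exp_mul_complex_Iic r1, integral_exp_mul_complex_Ioi r2]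
  have n1 : ((a : ℂ) - 2 * π * w * Complex.I) ≠ 0 := fun h => by rw [h] at r1; simp at r1
  have n2 : (-(a : ℂ) - 2 * π * w * Complex.I) ≠ 0 := fun h => by rw [h] at r2; simp at r2
  have n3 : ((2 * π * w : ℂ) ^ 2 + a ^ 2) ≠ 0 := by
    have : (2 * π * w) ^ 2 + a ^ 2 ≠ 0 := by positivity
    exact_mod_cast this
  have key : ((a : ℂ) - 2 * π * w * Complex.I) * (-(a : ℂ) - 2 * π * w * Complex.I) = -((2 * π * w : ℂ) ^ 2 + a ^ 2) := by
    ring_nf; rw [Complex.I_sq]; ring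
  push_cast
  simp only [mul_zero, Complex.exp_zero]
  rw [div_add_div _ _ n1 n2, key]
  field_simp
  ring

lemma lks_cos (a : ℝ) (ha : 0 < a) (h : ℝ) :
    ∫ τ : ℝ, Real.cos (h * τ) * (τ ^ 2 + a ^ 2)⁻¹ = π / a * Real.exp (-a * |h|) := by
  have hF : FourierTransform.fourier (fun x : ℝ => (Real.exp (-a * |x|) : ℂ)) = fun w : ℝ => ((2 * a * ((2 * π * w) ^ 2 + a ^ 2)⁻¹ : ℝ) : ℂ) :=
    funext fun w => lks_fourier a ha w
  have hi : Integrable (fun w : ℝ => ((2 * a * ((2 * π * w) ^ 2 + a ^ 2)⁻¹ : ℝ) : ℂ)) :=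
    (((lks_lor_int a ha).comp_mul_left' (R := 2 * π) (by positivity)).const_mul (2 * a)).ofReal
  have inv := congrFun (Continuous.fourierInv_fourier_eq (f := fun x : ℝ => (Real.exp (-a * |x|) : ℂ))
    (by fun_prop) (lks_exp_abs_int a ha) (by rw [hF]; exact hi)) h
  rw [hF, Real.fourierInv_eq'] at inv
  have inv2 := congrArg Complex.re inv
  have hi2 : Integrable (fun v : ℝ => Complex.exp (↑(2 * π * inner ℝ v h) * Complex.I) • ((2 * a * ((2 * π * v) ^ 2 + a ^ 2)⁻¹ : ℝ) : ℂ)) := by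
    refine hi.bdd_mul (c := 1) ?_ ?_
    · apply Continuous.aestronglyMeasurable; fun_prop
    · exact Filter.Eventually.of_forall fun v => by rw [Complex.norm_exp_ofReal_mul_I]
  have := integral_re hi2
  simp only [RCLike.re_to_complex] at this
  rw [← this, Complex.ofReal_re] at inv2
  have e : ∀ v : ℝ, (Complex.exp (↑(2 * π * inner ℝ v h) * Complex.I) • ((2 * a * ((2 * π * v) ^ 2 + a ^ 2)⁻¹ : ℝ) : ℂ)).re
      = (fun τ => 2 * a * (Real.cos (h * τ) * (τ ^ 2 + a ^ 2)⁻¹)) (2 * π * v) := by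
    intro v
    rw [smul_eq_mul, Complex.re_mul_ofReal, Complex.exp_ofReal_mul_I_re]
    simp only [RCLike.inner_apply, conj_trivial]
    rw [show 2 * π * (h * v) = h * (2 * π * v) by ring]; ring
  simp_rw [e] at inv2
  have inv2 := (Measure.integral_comp_mul_left (fun τ => 2 * a * (Real.cos (h * τ) * (τ ^ 2 + a ^ 2)⁻¹)) (2 * π)).symm.trans inv2
  rw [integral_const_mul, abs_of_pos (by positivity), smul_eq_mul] at inv2
  rw [← inv2]
  field_simp

lemma lks_rhs_int (a : ℝ) (ha : 0 < a) (h : ℝ) :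
    Integrable (fun τ : ℝ => (1 - Real.cos (h * τ)) * (τ ^ 2 + a ^ 2)⁻¹) := by
  refine (lks_lor_int a ha).bdd_mul (c := 2) ?_ ?_
  · apply Continuous.aestronglyMeasurable; fun_prop
  · refine Filter.Eventually.of_forall fun v => ?_
    rw [Real.norm_eq_abs, abs_le]
    constructor <;> linarith [Real.neg_one_le_cos (h * v), Real.cos_le_one (h * v)]

lemma lks_rhs (a : ℝ) (ha : 0 < a) (h : ℝ) :
    ∫ τ : ℝ, (1 - Real.cos (h * τ)) * (τ ^ 2 + a ^ 2)⁻¹ = π * ((1 - Real.exp (-a * |h|)) / a) := by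
  have h0 := lks_cos a ha 0
  simp only [zero_mul, Real.cos_zero, one_mul, abs_zero, mul_zero, Real.exp_zero] at h0
  have hc : Integrable (fun τ : ℝ => Real.cos (h * τ) * (τ ^ 2 + a ^ 2)⁻¹) := by
    refine (lks_lor_int a ha).bdd_mul (c := 1) ?_ ?_
    · apply Continuous.aestronglyMeasurable; fun_prop
    · exact Filter.Eventually.of_forall fun v => Real.abs_cos_le_one _
  simp_rw [sub_mul, one_mul]
  rw [integral_sub (lks_lor_int a ha) hc, lks_cos a ha h, h0]
  field_simp

lemma lks_prod (a : ℝ) (ha : 0 < a) (s t : ℝ) :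
    Integrable (fun r : ℝ => (if r < t then Real.exp (-(a * (t - r))) else 0) * (if r < s then Real.exp (-(a * (s - r))) else 0)) ∧
    ∫ r : ℝ, (if r < t then Real.exp (-(a * (t - r))) else 0) * (if r < s then Real.exp (-(a * (s - r))) else 0)
      = Real.exp (-a * |t - s|) / (2 * a) := by
  have e : (fun r : ℝ => (if r < t then Real.exp (-(a * (t - r))) else 0) * (if r < s then Real.exp (-(a * (s - r))) else 0))
      = (Set.Iio (min t s)).indicator (fun r => Real.exp (-(a * (t + s))) * Real.exp ((2 * a) * r)) := by
    funext r
    simp only [Set.indicator, Set.mem_Iio, lt_min_iff]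
    by_cases h1 : r < t <;> by_cases h2 : r < s <;> simp [h1, h2]
    rw [← Real.exp_add, ← Real.exp_add]; congr 1; ring
  have ha2 : 0 < 2 * a := by positivity
  rw [e]
  constructor
  · rw [integrable_indicator_iff measurableSet_Iio]
    exact ((integrableOn_exp_mul_Iic ha2 _).mono_set Set.Iio_subset_Iic_self).const_mul _
  · rw [integral_indicator measurableSet_Iio, ← integral_Iic_eq_integral_Iio, integral_const_mul, integral_exp_mul_Iic ha2,
      ← mul_div_assoc, ← Real.exp_add]
    congr 2
    have : t + s - 2 * min t s = |t - s| := by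
      rcases le_total t s with h | h
      · rw [min_eq_left h, abs_of_nonpos (by linarith)]; ring
      · rw [min_eq_right h, abs_of_nonneg (by linarith)]; ring
    rw [← this]; ring

lemma lks_lhs (a : ℝ) (ha : 0 < a) (s t : ℝ) :
    Integrable (fun r : ℝ => ((if r < t then Real.exp (-(a * (t - r))) else 0) - (if r < s then Real.exp (-(a * (s - r))) else 0)) ^ 2) ∧
    ∫ r : ℝ, ((if r < t then Real.exp (-(a * (t - r))) else 0) - (if r < s then Real.exp (-(a * (s - r))) else 0)) ^ 2
      = (1 - Real.exp (-a * |t - s|)) / a := by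
  obtain ⟨i1, v1⟩ := lks_prod a ha t t
  obtain ⟨i2, v2⟩ := lks_prod a ha s s
  obtain ⟨i3, v3⟩ := lks_prod a ha s t
  have e : (fun r : ℝ => ((if r < t then Real.exp (-(a * (t - r))) else 0) - (if r < s then Real.exp (-(a * (s - r))) else 0)) ^ 2)
    = fun r => ((if r < t then Real.exp (-(a * (t - r))) else 0) * (if r < t then Real.exp (-(a * (t - r))) else 0)
      + (if r < s then Real.exp (-(a * (s - r))) else 0) * (if r < s then Real.exp (-(a * (s - r))) else 0))
      - 2 * ((if r < t then Real.exp (-(a * (t - r))) else 0) * (if r < s then Real.exp (-(a * (s - r))) else 0)) := by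
    funext r; ring
  rw [e]
  refine ⟨(i1.add i2).sub (i3.const_mul 2), ?_⟩
  have i12 := i1.add i2
  simp only [Pi.add_def] at i12
  rw [integral_sub i12 (i3.const_mul 2), integral_add i1 i2, integral_const_mul, v1, v2, v3]
  simp only [sub_self, abs_zero, mul_zero, Real.exp_zero]
  field_simp
  ring

lemma lks_G_int (d : ℕ) (hd : d = 1 ∨ d = 2 ∨ d = 3) (ε ϑ : ℝ) (hε : 0 < ε) (h : ℝ) (hh : 0 ≤ h) :
    Integrable (fun ξ : EuclideanSpace ℝ (Fin d) =>
      (1 - Real.exp (-(ε / 8 * (-2 * ϑ + ‖ξ‖ ^ 2) ^ 2) * h)) / (ε / 8 * (-2 * ϑ + ‖ξ‖ ^ 2) ^ 2)) := by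
  have hb : Integrable (fun ξ : EuclideanSpace ℝ (Fin d) => (1 + ‖ξ‖) ^ (-(4 : ℝ))) := by
    apply integrable_one_add_norm
    rw [finrank_euclideanSpace_fin]
    rcases hd with rfl | rfl | rfl <;> norm_num
  have hbC := hb.const_mul (h * (4 + 8 * |ϑ|) ^ 2 + 512 / ε)
  refine hbC.mono' ?_ (Filter.Eventually.of_forall fun ξ => ?_)
  · apply Measurable.aestronglyMeasurable
    fun_prop
  · have hx : 0 ≤ ‖ξ‖ := norm_nonneg ξ
    generalize ‖ξ‖ = x at hx
    have hpow : (1 + x) ^ (-(4 : ℝ)) = ((1 + x) ^ 4)⁻¹ := by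
      rw [Real.rpow_neg (by positivity)]
      norm_cast
    simp only [hpow]
    have hA : 0 ≤ ε / 8 * (-2 * ϑ + x ^ 2) ^ 2 := by positivity
    have hAl : 4 * |ϑ| + 1 ≤ x ^ 2 → ε / 512 * (1 + x) ^ 4 ≤ ε / 8 * (-2 * ϑ + x ^ 2) ^ 2 := by
      intro hc
      have h1 : x ^ 2 / 2 ≤ -2 * ϑ + x ^ 2 := by linarith [le_abs_self ϑ]
      have h0 : 1 ≤ x := by nlinarith [abs_nonneg ϑ]
      have h2 : (1 + x) ^ 2 / 8 ≤ -2 * ϑ + x ^ 2 := by nlinarith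
      have h3 : ((1 + x) ^ 2 / 8) ^ 2 ≤ (-2 * ϑ + x ^ 2) ^ 2 := by gcongr
      have h4 : ε / 8 * ((1 + x) ^ 2 / 8) ^ 2 ≤ ε / 8 * (-2 * ϑ + x ^ 2) ^ 2 := by gcongr
      refine le_trans (le_of_eq ?_) h4
      ring
    generalize ε / 8 * (-2 * ϑ + x ^ 2) ^ 2 = A at hA hAl
    have hnn : 0 ≤ 1 - Real.exp (-A * h) := by
      have : Real.exp (-A * h) ≤ 1 := Real.exp_le_one_iff.2 (by nlinarith)
      linarith
    rw [Real.norm_eq_abs, abs_of_nonneg (div_nonneg hnn hA), add_mul]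
    have p1 : 0 ≤ h * (4 + 8 * |ϑ|) ^ 2 * ((1 + x) ^ 4)⁻¹ := by positivity
    have p2 : 0 ≤ 512 / ε * ((1 + x) ^ 4)⁻¹ := by positivity
    by_cases hc : 4 * |ϑ| + 1 ≤ x ^ 2
    · have h1 := hAl hc
      have : (1 - Real.exp (-A * h)) / A ≤ 512 / ε * ((1 + x) ^ 4)⁻¹ := by
        calc (1 - Real.exp (-A * h)) / A ≤ 1 / (ε / 512 * (1 + x) ^ 4) := by
              apply div_le_div₀ zero_le_one _ (by positivity) h1
              linarith [Real.exp_pos (-A * h)]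
          _ = _ := by field_simp
      linarith
    · push Not at hc
      have h1 : (1 - Real.exp (-A * h)) / A ≤ h := by
        apply div_le_of_le_mul₀ hA hh
        linarith [Real.add_one_le_exp (-A * h)]
      have h2 : (1 + x) ^ 2 ≤ 4 + 8 * |ϑ| := by nlinarith [sq_nonneg (x - 1)]
      have h3 : (1 + x) ^ 4 ≤ (4 + 8 * |ϑ|) ^ 2 := by
        calc (1 + x) ^ 4 = ((1 + x) ^ 2) ^ 2 := by ring
          _ ≤ _ := by gcongr
      have h4 : h ≤ h * (4 + 8 * |ϑ|) ^ 2 * ((1 + x) ^ 4)⁻¹ := by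
        rw [← div_eq_mul_inv, le_div_iff₀ (by positivity)]
        gcongr
      linarith

lemma lks_ae (d : ℕ) (hd : d = 1 ∨ d = 2 ∨ d = 3) (ε ϑ : ℝ) (hε : 0 < ε) :
    ∀ᵐ ξ : EuclideanSpace ℝ (Fin d), 0 < ε / 8 * (-2 * ϑ + ‖ξ‖ ^ 2) ^ 2 := by
  have : Nonempty (Fin d) := by
    rcases hd with rfl | rfl | rfl <;> exact ⟨0⟩
  have h0 : volume (Metric.sphere (0 : EuclideanSpace ℝ (Fin d)) (√(2 * ϑ))) = 0 :=
    Measure.addHaar_sphere _ _ _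
  filter_upwards [measure_eq_zero_iff_ae_notMem.1 h0] with ξ hξ
  have : -2 * ϑ + ‖ξ‖ ^ 2 ≠ 0 := by
    intro h
    apply hξ
    rw [mem_sphere_zero_iff_norm, show 2 * ϑ = ‖ξ‖ ^ 2 by linarith, Real.sqrt_sq (norm_nonneg _)]
  positivity

theorem lks_temporal_increment_parseval
    (d : ℕ) (hd : d = 1 ∨ d = 2 ∨ d = 3) (ε ϑ : ℝ) (hε : 0 < ε)
    (s t : ℝ) (hs : 0 ≤ s) (ht : 0 ≤ t) :
    Integrable (fun p : EuclideanSpace ℝ (Fin d) × ℝ =>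
      ((if p.2 < t then Real.exp (-(ε * (t - p.2) / 8) * (-2 * ϑ + ‖p.1‖ ^ 2) ^ 2) else 0)
        - (if p.2 < s then Real.exp (-(ε * (s - p.2) / 8) * (-2 * ϑ + ‖p.1‖ ^ 2) ^ 2) else 0)) ^ 2) ∧
    Integrable (fun τ : ℝ => (1 - Real.cos ((t - s) * τ)) *
      ∫ ξ : EuclideanSpace ℝ (Fin d), (τ ^ 2 + ε ^ 2 / 64 * (-2 * ϑ + ‖ξ‖ ^ 2) ^ 4)⁻¹) ∧
    (∫ ξ : EuclideanSpace ℝ (Fin d), ∫ r : ℝ,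
      ((if r < t then Real.exp (-(ε * (t - r) / 8) * (-2 * ϑ + ‖ξ‖ ^ 2) ^ 2) else 0)
        - (if r < s then Real.exp (-(ε * (s - r) / 8) * (-2 * ϑ + ‖ξ‖ ^ 2) ^ 2) else 0)) ^ 2)
      = (1 / π) * ∫ τ : ℝ, (1 - Real.cos ((t - s) * τ)) *
          ∫ ξ : EuclideanSpace ℝ (Fin d), (τ ^ 2 + ε ^ 2 / 64 * (-2 * ϑ + ‖ξ‖ ^ 2) ^ 4)⁻¹ := by
  have hG := lks_G_int d hd ε ϑ hε |t - s| (abs_nonneg _)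
  have hae := lks_ae d hd ε ϑ hε
  have eL : ∀ (u r x : ℝ), -(ε * (u - r) / 8) * (-2 * ϑ + x ^ 2) ^ 2
      = -(ε / 8 * (-2 * ϑ + x ^ 2) ^ 2 * (u - r)) := fun u r x => by ring
  have eR : ∀ x : ℝ, ε ^ 2 / 64 * (-2 * ϑ + x ^ 2) ^ 4 = (ε / 8 * (-2 * ϑ + x ^ 2) ^ 2) ^ 2 :=
    fun x => by ring
  simp only [eL, eR]
  have I2 : Integrable (fun p : EuclideanSpace ℝ (Fin d) × ℝ => (1 - Real.cos ((t - s) * p.2)) *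
      (p.2 ^ 2 + (ε / 8 * (-2 * ϑ + ‖p.1‖ ^ 2) ^ 2) ^ 2)⁻¹) (volume.prod volume) := by
    rw [integrable_prod_iff (Measurable.aestronglyMeasurable (by fun_prop))]
    constructor
    · filter_upwards [hae] with ξ hξ
      exact lks_rhs_int _ hξ _
    · refine (hG.const_mul π).congr ?_
      filter_upwards [hae] with ξ hξ
      rw [← lks_rhs _ hξ (t - s)]
      refine integral_congr_ae (Filter.Eventually.of_forall fun τ => ?_)
      simp only [Real.norm_eq_abs]
      rw [abs_of_nonneg]
      exact mul_nonneg (by linarith [Real.cos_le_one ((t - s) * τ)]) (by positivity)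
  refine ⟨?_, ?_, ?_⟩
  · rw [Measure.volume_eq_prod, integrable_prod_iff]
    · constructor
      · filter_upwards [hae] with ξ hξ
        exact (lks_lhs _ hξ s t).1
      · refine hG.congr ?_
        filter_upwards [hae] with ξ hξ
        rw [← (lks_lhs _ hξ s t).2]
        refine integral_congr_ae (Filter.Eventually.of_forall fun r => ?_)
        simp only [Real.norm_eq_abs]
        rw [abs_of_nonneg (sq_nonneg _)]
    · apply Measurable.aestronglyMeasurable
      apply Measurable.pow_const
      apply Measurable.sub
      · exact Measurable.ite (measurableSet_lt measurable_snd measurable_const) (by fun_prop) measurable_const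
      · exact Measurable.ite (measurableSet_lt measurable_snd measurable_const) (by fun_prop) measurable_const
  · have := I2.integral_prod_right
    simpa only [integral_const_mul] using this
  · simp only [← integral_const_mul (_ - _)]
    rw [← integral_integral_swap (f := fun (ξ : EuclideanSpace ℝ (Fin d)) (τ : ℝ) => (1 - Real.cos ((t - s) * τ)) *
      (τ ^ 2 + (ε / 8 * (-2 * ϑ + ‖ξ‖ ^ 2) ^ 2) ^ 2)⁻¹) I2, ← integral_const_mul]
    refine integral_congr_ae ?_
    filter_upwards [hae] with ξ hξ
    rw [(lks_lhs _ hξ s t).2, lks_rhs _ hξ (t - s)]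
    field_simp
end

section
/- Let d ∈ {1,2,3}, ε > 0, ϑ ∈ ℝ and a > 0. There exists a finite constant C (depending only on d, ε, ϑ, a) such that for all s, t with a ≤ s ≤ t, ∫_{ℝ^d} (-2ϑ+|ξ|²)² · exp(-(εs/4)·(-2ϑ+|ξ|²)²) · (1 − exp(-(ε(t−s)/8)·(-2ϑ+|ξ|²)²))² dξ ≤ C·(t−s)². -/
open MeasureTheory Real

/-- Core analytic bound for the smoothness of the regular part of the L-KS decomposition:
there is `C` with
`∫ (-2ϑ+|ξ|²)² e^{-(εs/4)(-2ϑ+|ξ|²)²} (1 − e^{-(ε(t−s)/8)(-2ϑ+|ξ|²)²})² dξ ≤ C (t−s)²`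
for all `a ≤ s ≤ t`. -/
theorem lks_smooth_part_derivative_bound
    (d : ℕ) (hd : d = 1 ∨ d = 2 ∨ d = 3) (ε ϑ a : ℝ) (hε : 0 < ε) (ha : 0 < a) :
    ∃ C : ℝ, ∀ s t : ℝ, a ≤ s → s ≤ t →
      (∫ ξ : EuclideanSpace ℝ (Fin d),
        (-2 * ϑ + ‖ξ‖ ^ 2) ^ 2 * Real.exp (-(ε * s / 4) * (-2 * ϑ + ‖ξ‖ ^ 2) ^ 2) *
          (1 - Real.exp (-(ε * (t - s) / 8) * (-2 * ϑ + ‖ξ‖ ^ 2) ^ 2)) ^ 2)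
        ≤ C * (t - s) ^ 2 := by
  obtain ⟨c, hc⟩ : ∃ c, c = ε * a / 4 := ⟨_, rfl⟩
  have hc0 : 0 < c := by rw [hc]; positivity
  have hint : Integrable (fun ξ : EuclideanSpace ℝ (Fin d) => Real.exp (-c * ‖ξ‖ ^ 2)) := by
    have h := GaussianFourier.integrable_cexp_neg_mul_sq_norm_add (V := EuclideanSpace ℝ (Fin d))
      (b := (c : ℂ)) (by simpa using hc0) 0 0
    have h2 := h.norm
    refine h2.congr (Filter.Eventually.of_forall fun ξ => ?_)
    simp only [Complex.norm_exp]
    congr 1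
    simp [← Complex.ofReal_pow]
  refine ⟨∫ ξ : EuclideanSpace ℝ (Fin d),
    ((ε / 8) ^ 2 * (48 / c ^ 3) * Real.exp (c / 2 + 2 * ϑ * c)) * Real.exp (-c * ‖ξ‖ ^ 2), ?_⟩
  intro s t has hst
  rw [← integral_mul_const]
  refine integral_mono_of_nonneg (Filter.Eventually.of_forall fun ξ => ?_)
    ((hint.const_mul _).mul_const _) (Filter.Eventually.of_forall fun ξ => ?_)
  · positivity
  · simp only
    obtain ⟨w, hw⟩ : ∃ w, w = -2 * ϑ + ‖ξ‖ ^ 2 := ⟨_, rfl⟩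
    rw [← hw]
    have hu : 0 ≤ w ^ 2 := sq_nonneg w
    have hts : 0 ≤ t - s := by linarith
    have e1 : Real.exp (-(ε * s / 4) * w ^ 2) ≤ Real.exp (-c * w ^ 2) := by
      apply Real.exp_le_exp.2
      apply mul_le_mul_of_nonneg_right _ hu
      rw [hc]
      have := mul_le_mul_of_nonneg_left has hε.le
      linarith
    have e2 : (1 - Real.exp (-(ε * (t - s) / 8) * w ^ 2)) ^ 2 ≤ (ε * (t - s) / 8 * w ^ 2) ^ 2 := by
      have h0 : 0 ≤ ε * (t - s) / 8 * w ^ 2 := by positivity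
      have h1 := Real.add_one_le_exp (-(ε * (t - s) / 8) * w ^ 2)
      have h2 : Real.exp (-(ε * (t - s) / 8) * w ^ 2) ≤ 1 := by
        apply Real.exp_le_one_iff.2; linarith
      apply pow_le_pow_left₀ <;> linarith
    have e3 : (w ^ 2) ^ 3 ≤ 48 / c ^ 3 * Real.exp (c * w ^ 2 / 2) := by
      have h := Real.pow_div_factorial_le_exp (c * w ^ 2 / 2) (by positivity) 3
      have h6 : ((Nat.factorial 3 : ℕ) : ℝ) = 6 := by norm_num [Nat.factorial]
      rw [h6] at h
      calc (w ^ 2) ^ 3 = 48 / c ^ 3 * ((c * w ^ 2 / 2) ^ 3 / 6) := by field_simp; ring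
        _ ≤ _ := by gcongr
    have e4 : Real.exp (c * w ^ 2 / 2) * Real.exp (-c * w ^ 2)
        ≤ Real.exp (c / 2 + 2 * ϑ * c) * Real.exp (-c * ‖ξ‖ ^ 2) := by
      rw [← Real.exp_add, ← Real.exp_add]
      apply Real.exp_le_exp.2
      have : ‖ξ‖ ^ 2 = w + 2 * ϑ := by linarith
      rw [this]
      nlinarith [mul_nonneg hc0.le (sq_nonneg (w - 1))]
    calc _ ≤ w ^ 2 * Real.exp (-c * w ^ 2) * (ε * (t - s) / 8 * w ^ 2) ^ 2 := by gcongr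
      _ = (ε / 8) ^ 2 * (t - s) ^ 2 * ((w ^ 2) ^ 3 * Real.exp (-c * w ^ 2)) := by ring
      _ ≤ (ε / 8) ^ 2 * (t - s) ^ 2 *
          ((48 / c ^ 3 * Real.exp (c * w ^ 2 / 2)) * Real.exp (-c * w ^ 2)) := by gcongr
      _ = (ε / 8) ^ 2 * (t - s) ^ 2 * (48 / c ^ 3) *
          (Real.exp (c * w ^ 2 / 2) * Real.exp (-c * w ^ 2)) := by ring
      _ ≤ (ε / 8) ^ 2 * (t - s) ^ 2 * (48 / c ^ 3) *
          (Real.exp (c / 2 + 2 * ϑ * c) * Real.exp (-c * ‖ξ‖ ^ 2)) := by gcongr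
      _ = _ := by ring
end

section
/- Let d ∈ {1,2,3}, ε > 0 and ϑ ∈ ℝ. There exists a finite constant C (depending only on d, ε, ϑ) such that for all s, t with 0 < s ≤ t and s ≤ 1, ∫_{ℝ^d} exp(-(εs/4)·(-2ϑ+|ξ|²)²) · (1 − exp(-(ε(t−s)/8)·(-2ϑ+|ξ|²)²))² · (-2ϑ+|ξ|²)^{-2} dξ ≤ C · s^{(4-d)/4 − 2} · (t−s)², where the integrand is extended by continuity at points with -2ϑ+|ξ|² = 0. -/
open MeasureTheory Real

lemma lks_pointwise (ε ϑ s t r : ℝ) (hε : 0 < ε) (hs : 0 < s) (hst : s ≤ t) (hs1 : s ≤ 1) :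
    Real.exp (-(ε * s / 4) * (-2 * ϑ + r ^ 2) ^ 2) *
          (1 - Real.exp (-(ε * (t - s) / 8) * (-2 * ϑ + r ^ 2) ^ 2)) ^ 2 *
            ((-2 * ϑ + r ^ 2) ^ 2)⁻¹ ≤
      (ε / 8 * (t - s) ^ 2 * s⁻¹ * Real.exp (ε / 8 * (1 / 2 + 4 * ϑ ^ 2))) *
        Real.exp (-(ε / 8 * √s) * r ^ 2) := by
  set Q : ℝ := -2 * ϑ + r ^ 2 with hQ
  have hts : 0 ≤ t - s := by linarith
  by_cases hQ0 : Q = 0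
  · rw [hQ0]; simp; positivity
  have hQ2 : 0 < Q ^ 2 := by positivity
  set a := ε * (t - s) / 8 with ha
  have ha0 : 0 ≤ a := by positivity
  have h1 : (1 - Real.exp (-a * Q ^ 2)) ^ 2 ≤ (a * Q ^ 2) ^ 2 := by
    have h2 := Real.add_one_le_exp (-a * Q ^ 2)
    have h3 : Real.exp (-a * Q ^ 2) ≤ 1 := Real.exp_le_one_iff.2 (by nlinarith)
    apply pow_le_pow_left₀ <;> linarith
  set x := ε * s / 8 * Q ^ 2 with hx
  have hx0 : 0 < x := by positivity
  have h4 : x * Real.exp (-x) ≤ 1 := by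
    rw [Real.exp_neg, ← div_eq_mul_inv, div_le_one (Real.exp_pos _)]
    linarith [Real.add_one_le_exp x]
  have h5 : Real.exp (-x) ≤ Real.exp (ε / 8 * (1 / 2 + 4 * ϑ ^ 2)) *
      Real.exp (-(ε / 8 * √s) * r ^ 2) := by
    rw [← Real.exp_add]
    apply Real.exp_le_exp.2
    have hsq : √s ^ 2 = s := Real.sq_sqrt hs.le
    have h6 : √s * r ^ 2 - 1 / 2 - 4 * ϑ ^ 2 ≤ s * Q ^ 2 := by
      have e1 : r ^ 4 / 2 - 4 * ϑ ^ 2 ≤ Q ^ 2 := by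
        rw [hQ]; nlinarith [sq_nonneg (r ^ 2 - 4 * ϑ)]
      have e2 := mul_le_mul_of_nonneg_left e1 hs.le
      have e3 : s * r ^ 4 = (√s * r ^ 2) ^ 2 := by rw [mul_pow, hsq]; ring
      nlinarith [sq_nonneg (√s * r ^ 2 - 1), mul_nonneg (sub_nonneg.2 hs1) (sq_nonneg ϑ)]
    have := mul_le_mul_of_nonneg_left h6 (by positivity : 0 ≤ ε / 8)
    rw [hx]; linarith
  have h7 : Real.exp (-(ε * s / 4) * Q ^ 2) = Real.exp (-x) * Real.exp (-x) := by
    rw [← Real.exp_add]; congr 1; rw [hx]; ring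
  rw [h7]
  calc _ ≤ Real.exp (-x) * Real.exp (-x) * (a * Q ^ 2) ^ 2 * (Q ^ 2)⁻¹ := by gcongr
    _ = (ε / 8 * (t - s) ^ 2 * s⁻¹) * (x * Real.exp (-x)) * Real.exp (-x) := by
      rw [ha]
      generalize Real.exp (-x) = E
      rw [hx]; field_simp
    _ ≤ (ε / 8 * (t - s) ^ 2 * s⁻¹) * 1 * (Real.exp (ε / 8 * (1 / 2 + 4 * ϑ ^ 2)) *
      Real.exp (-(ε / 8 * √s) * r ^ 2)) := by gcongr
    _ = _ := by ring

/-- Small-time oscillation bound for the smooth part of the L-KS decomposition: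
there is `C` with
`∫ e^{-(εs/4)Q²} (1 − e^{-(ε(t−s)/8)Q²})² Q^{-2} dξ ≤ C s^{(4-d)/4 - 2} (t−s)²`
for `0 < s ≤ t`, `s ≤ 1`, where `Q = -2ϑ+|ξ|²` (the integrand, extended by continuity
where `Q = 0`, vanishes there, matching the convention `(0)⁻¹ = 0`). -/
theorem lks_smooth_part_small_time_bound
    (d : ℕ) (hd : d = 1 ∨ d = 2 ∨ d = 3) (ε ϑ : ℝ) (hε : 0 < ε) :
    ∃ C : ℝ, ∀ s t : ℝ, 0 < s → s ≤ t → s ≤ 1 →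
      (∫ ξ : EuclideanSpace ℝ (Fin d),
        Real.exp (-(ε * s / 4) * (-2 * ϑ + ‖ξ‖ ^ 2) ^ 2) *
          (1 - Real.exp (-(ε * (t - s) / 8) * (-2 * ϑ + ‖ξ‖ ^ 2) ^ 2)) ^ 2 *
            ((-2 * ϑ + ‖ξ‖ ^ 2) ^ 2)⁻¹)
        ≤ C * s ^ ((4 - (d : ℝ)) / 4 - 2) * (t - s) ^ 2 := by
  refine ⟨ε / 8 * Real.exp (ε / 8 * (1 / 2 + 4 * ϑ ^ 2)) * (π / (ε / 8)) ^ ((d : ℝ) / 2), ?_⟩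
  intro s t hs hst hs1
  have hb : 0 < ε / 8 * √s := by positivity
  have hG : ∫ ξ : EuclideanSpace ℝ (Fin d), Real.exp (-(ε / 8 * √s) * ‖ξ‖ ^ 2) =
      (π / (ε / 8 * √s)) ^ ((d : ℝ) / 2) := by
    have := GaussianFourier.integral_rexp_neg_mul_sq_norm (V := EuclideanSpace ℝ (Fin d)) hb
    simpa using this
  have hI : Integrable (fun ξ : EuclideanSpace ℝ (Fin d) =>
      Real.exp (-(ε / 8 * √s) * ‖ξ‖ ^ 2)) := by
    by_contra h
    rw [integral_undef h] at hG
    have : 0 < (π / (ε / 8 * √s)) ^ ((d : ℝ) / 2) := by positivity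
    linarith
  refine (integral_mono_of_nonneg (Filter.Eventually.of_forall fun ξ => by positivity)
    (hI.const_mul _) (Filter.Eventually.of_forall fun ξ =>
      lks_pointwise ε ϑ s t ‖ξ‖ hε hs hst hs1)).trans ?_
  rw [integral_const_mul, hG]
  have hp : (π / (ε / 8 * √s)) ^ ((d : ℝ) / 2) =
      (π / (ε / 8)) ^ ((d : ℝ) / 2) * s ^ (-((d : ℝ) / 4)) := by
    rw [← div_div, Real.div_rpow (by positivity) (by positivity), Real.sqrt_eq_rpow,
      ← Real.rpow_mul hs.le, div_eq_mul_inv, ← Real.rpow_neg hs.le]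
    congr 2; ring
  have hq : s ^ ((4 - (d : ℝ)) / 4 - 2) = s⁻¹ * s ^ (-((d : ℝ) / 4)) := by
    rw [← Real.rpow_neg_one, ← Real.rpow_add hs]; congr 1; ring
  rw [hp, hq]
  apply le_of_eq; ring
end

section
/- Fix d ∈ {1,2,3}, ε > 0, ϑ ∈ ℝ and T > 0. There exist constants 0 < c₁ ≤ c₂ < ∞ such that for every h ∈ [0, T], c₁ · h^{(4-d)/4} ≤ ∫_ℝ (1 − cos(hτ)) · [ ∫_{ℝ^d} (τ² + (ε²/64)·(-2ϑ+|ξ|²)⁴)^{-1} dξ ] dτ ≤ c₂ · h^{(4-d)/4}. -/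
open MeasureTheory Real

lemma lks_pow4 (x y : ℝ) : (x + y) ^ 4 ≤ 8 * (x ^ 4 + y ^ 4) := by
  have h1 : (x + y) ^ 2 ≤ 2 * (x ^ 2 + y ^ 2) := by nlinarith [sq_nonneg (x - y)]
  have h2 : ((x + y) ^ 2) ^ 2 ≤ (2 * (x ^ 2 + y ^ 2)) ^ 2 :=
    pow_le_pow_left₀ (sq_nonneg _) h1 2
  nlinarith [sq_nonneg (x ^ 2 - y ^ 2)]

lemma lks_compare (c a δ : ℝ) (hc : 0 < c) (hδ : 0 < δ) :
    ∃ K : ℝ, 0 < K ∧ ∀ τ r : ℝ, δ ≤ |τ| →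
      τ ^ 2 + r ^ 4 ≤ K * (τ ^ 2 + c * (a + r) ^ 4) ∧
      τ ^ 2 + c * (a + r) ^ 4 ≤ K * (τ ^ 2 + r ^ 4) := by
  refine ⟨1 + 8 * (a ^ 4 / δ ^ 2) + 8 / c + 8 * c * (a ^ 4 / δ ^ 2) + 8 * c, by positivity, ?_⟩
  intro τ r hτ
  have h2 : δ ^ 2 ≤ τ ^ 2 := by
    rw [← sq_abs τ]; exact pow_le_pow_left₀ hδ.le hτ 2
  have h3 : a ^ 4 ≤ a ^ 4 / δ ^ 2 * τ ^ 2 := by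
    have : a ^ 4 = a ^ 4 / δ ^ 2 * δ ^ 2 := by field_simp
    calc a ^ 4 = a ^ 4 / δ ^ 2 * δ ^ 2 := this
      _ ≤ _ := by gcongr
  have h4 := lks_pow4 (a + r) (-a)
  have h5 := lks_pow4 a r
  have e1 : a + r + -a = r := by ring
  have e2 : (-a) ^ 4 = a ^ 4 := by ring
  rw [e1, e2] at h4
  have hs : 0 ≤ (a + r) ^ 4 := by positivity
  have hr : 0 ≤ r ^ 4 := by positivity
  have hA : 0 ≤ a ^ 4 / δ ^ 2 := by positivity
  generalize (a + r) ^ 4 = s at *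
  generalize r ^ 4 = q at *
  generalize a ^ 4 / δ ^ 2 = m at *
  have ht : 0 ≤ τ ^ 2 := sq_nonneg _
  generalize τ ^ 2 = t at *
  have h6 : 8 / c * (c * s) = 8 * s := by field_simp
  have hc8 : 0 ≤ 8 / c := by positivity
  generalize 8 / c = k at *
  have p1 : 0 ≤ m * t := by positivity
  have p2 : 0 ≤ c * (m * t) := by positivity
  have p3 : 0 ≤ c * s := by positivity
  have p4 : 0 ≤ m * (c * s) := by positivity
  have p5 : 0 ≤ c * (m * (c * s)) := by positivity
  have p6 : 0 ≤ c * (c * s) := by positivity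
  have p7 : 0 ≤ k * t := by positivity
  have p8 : 0 ≤ c * t := by positivity
  have p9 : 0 ≤ m * q := by positivity
  have p10 : 0 ≤ k * q := by positivity
  have p11 : 0 ≤ c * (m * q) := by positivity
  have h7 : c * s ≤ c * (8 * (m * t + q)) := by
    apply mul_le_mul_of_nonneg_left _ hc.le
    linarith
  constructor
  · nlinarith
  · nlinarith

/-- model integrand -/
lemma lks_model_int (d : ℕ) (hd : d < 8) :
    Integrable (fun ξ : EuclideanSpace ℝ (Fin d) => (1 + (‖ξ‖ ^ 2) ^ 4)⁻¹) := by
  have h := integrable_one_add_norm (E := EuclideanSpace ℝ (Fin d)) (μ := volume) (r := 8)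
    (by simp; exact_mod_cast hd)
  refine (h.const_mul 128).mono' ?_ ?_
  · refine Continuous.aestronglyMeasurable ?_
    refine Continuous.inv₀ (by fun_prop) ?_
    intro x; positivity
  · refine Filter.Eventually.of_forall fun x => ?_
    rw [Real.norm_of_nonneg (by positivity)]
    have e : (1 + ‖x‖) ^ (-8 : ℝ) = ((1 + ‖x‖) ^ 8)⁻¹ := by
      rw [Real.rpow_neg (by positivity)]; norm_cast
    rw [e]
    have h1 := lks_pow4 1 (‖x‖ ^ 2)
    have h2 : (1 + ‖x‖) ^ 2 ≤ 2 * (1 + ‖x‖ ^ 2) := by nlinarith [sq_nonneg (1 - ‖x‖)]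
    have h3 : ((1 + ‖x‖) ^ 2) ^ 4 ≤ (2 * (1 + ‖x‖ ^ 2)) ^ 4 :=
      pow_le_pow_left₀ (sq_nonneg _) h2 4
    have h4 : (1 + ‖x‖) ^ 8 ≤ 128 * (1 + (‖x‖ ^ 2) ^ 4) := by
      calc (1 + ‖x‖) ^ 8 = ((1 + ‖x‖) ^ 2) ^ 4 := by ring
        _ ≤ _ := h3
        _ = 16 * (1 + ‖x‖ ^ 2) ^ 4 := by ring
        _ ≤ 16 * (8 * (1 ^ 4 + (‖x‖ ^ 2) ^ 4)) := by gcongr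
        _ = _ := by ring
    rw [← div_eq_mul_inv, inv_eq_one_div, div_le_div_iff₀ (by positivity) (by positivity)]
    linarith

lemma lks_scale_pt (d : ℕ) (τ : ℝ) (hτ : τ ≠ 0) (ξ : EuclideanSpace ℝ (Fin d)) :
    (τ ^ 2 + (‖ξ‖ ^ 2) ^ 4)⁻¹
      = (τ ^ 2)⁻¹ * (1 + (‖(|τ| ^ (-(1/4) : ℝ)) • ξ‖ ^ 2) ^ 4)⁻¹ := by
  have hp : 0 < |τ| := abs_pos.mpr hτ
  have e : (|τ| ^ (-(1/4) : ℝ)) ^ 8 = (τ ^ 2)⁻¹ := by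
    rw [← Real.rpow_natCast, ← Real.rpow_mul hp.le, ← sq_abs, ← Real.rpow_natCast,
      ← Real.rpow_neg hp.le]
    norm_num
  rw [norm_smul, Real.norm_of_nonneg (by positivity), ← mul_inv]
  congr 1
  have : ((|τ| ^ (-(1/4) : ℝ) * ‖ξ‖) ^ 2) ^ 4 = (|τ| ^ (-(1/4) : ℝ)) ^ 8 * (‖ξ‖ ^ 2) ^ 4 := by ring
  rw [this, e]
  field_simp

lemma lks_H_int (d : ℕ) (hd : d < 8) (τ : ℝ) (hτ : τ ≠ 0) :
    Integrable (fun ξ : EuclideanSpace ℝ (Fin d) => (τ ^ 2 + (‖ξ‖ ^ 2) ^ 4)⁻¹) := by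
  have hp : 0 < |τ| := abs_pos.mpr hτ
  simp_rw [lks_scale_pt d τ hτ]
  exact ((lks_model_int d hd).comp_smul (Real.rpow_pos_of_pos hp _).ne').const_mul _

lemma lks_H_eq (d : ℕ) (τ : ℝ) (hτ : τ ≠ 0) :
    ∫ ξ : EuclideanSpace ℝ (Fin d), (τ ^ 2 + (‖ξ‖ ^ 2) ^ 4)⁻¹
      = |τ| ^ (-(2 - (d:ℝ) / 4)) *
        ∫ ξ : EuclideanSpace ℝ (Fin d), (1 + (‖ξ‖ ^ 2) ^ 4)⁻¹ := by
  have hp : 0 < |τ| := abs_pos.mpr hτ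
  simp_rw [lks_scale_pt d τ hτ]
  rw [integral_const_mul,
    Measure.integral_comp_smul volume
      (fun ξ : EuclideanSpace ℝ (Fin d) => (1 + (‖ξ‖ ^ 2) ^ 4)⁻¹)]
  rw [smul_eq_mul, ← mul_assoc]
  congr 1
  rw [finrank_euclideanSpace_fin, abs_of_pos (by positivity), ← sq_abs τ, ← Real.rpow_natCast,
    ← Real.rpow_natCast, ← Real.rpow_neg hp.le, ← Real.rpow_mul hp.le, ← Real.rpow_neg hp.le,
    ← Real.rpow_add hp]
  congr 1
  push_cast
  ring

lemma lks_H_pos (d : ℕ) (hd : d < 8) :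
    0 < ∫ ξ : EuclideanSpace ℝ (Fin d), (1 + (‖ξ‖ ^ 2) ^ 4)⁻¹ := by
  refine integral_pos_of_integrable_nonneg_nonzero (x := 0) ?_ (lks_model_int d hd) ?_ ?_
  · refine Continuous.inv₀ (by fun_prop) ?_
    intro x; positivity
  · intro x; positivity
  · positivity

lemma lks_cos_bound (x : ℝ) : 1 - Real.cos x ≤ x ^ 2 / 2 := by
  linarith [Real.one_sub_sq_div_two_le_cos (x := x)]

lemma lks_g_int (p : ℝ) (h1 : 1 < p) (h2 : p < 2) :
    Integrable (fun u : ℝ => (1 - Real.cos u) * |u| ^ (-p)) := by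
  have h := integrable_one_add_norm (E := ℝ) (μ := volume) (r := p) (by simpa using h1)
  refine (h.const_mul (2 * 2 ^ p)).mono' ?_ ?_
  · exact (by fun_prop : Measurable (fun u : ℝ => (1 - Real.cos u) * |u| ^ (-p))).aestronglyMeasurable
  · refine Filter.Eventually.of_forall fun u => ?_
    have hc : 0 ≤ 1 - Real.cos u := by linarith [Real.cos_le_one u]
    have hc2 : 1 - Real.cos u ≤ 2 := by linarith [Real.neg_one_le_cos u]
    rw [Real.norm_of_nonneg (by positivity), Real.norm_eq_abs]
    have e : 2 * 2 ^ p * (1 + |u|) ^ (-p) = 2 * ((1 + |u|) / 2) ^ (-p) := by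
      rw [Real.div_rpow (by positivity) (by norm_num), Real.rpow_neg (x := 2) (by norm_num)]
      field_simp
    rw [e]
    rcases eq_or_ne u 0 with rfl | hu
    · simp; positivity
    have hp : 0 < |u| := abs_pos.mpr hu
    rcases le_total |u| 1 with hu1 | hu1
    · have a1 : (1 - Real.cos u) * |u| ^ (-p) ≤ 1 := by
        calc (1 - Real.cos u) * |u| ^ (-p) ≤ (|u| ^ (2:ℝ)) * |u| ^ (-p) := by
              gcongr
              have := lks_cos_bound u
              rw [Real.rpow_two, sq_abs]
              nlinarith [sq_nonneg u]
          _ = |u| ^ (2 + -p) := by rw [Real.rpow_add hp]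
          _ ≤ 1 := Real.rpow_le_one hp.le hu1 (by linarith)
      have a2 : 1 ≤ ((1 + |u|) / 2) ^ (-p) :=
        Real.one_le_rpow_of_pos_of_le_one_of_nonpos (by positivity) (by linarith) (by linarith)
      linarith
    · apply mul_le_mul hc2 _ (by positivity) (by norm_num)
      exact Real.rpow_le_rpow_of_nonpos (by positivity) (by linarith) (by linarith)

lemma lks_g_scale (p h : ℝ) (hh : 0 < h) (τ : ℝ) :
    (1 - Real.cos (h * τ)) * |τ| ^ (-p)
      = h ^ p * ((1 - Real.cos (h * τ)) * |h * τ| ^ (-p)) := by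
  rw [abs_mul, abs_of_pos hh, Real.mul_rpow hh.le (abs_nonneg _), Real.rpow_neg hh.le]
  have : h ^ p ≠ 0 := (Real.rpow_pos_of_pos hh p).ne'
  field_simp

lemma lks_gh_int (p h : ℝ) (h1 : 1 < p) (h2 : p < 2) (hh : 0 < h) :
    Integrable (fun τ : ℝ => (1 - Real.cos (h * τ)) * |τ| ^ (-p)) := by
  simp_rw [lks_g_scale p h hh]
  exact ((lks_g_int p h1 h2).comp_mul_left' hh.ne').const_mul _

lemma lks_gh_eq (p h : ℝ) (hh : 0 < h) :
    ∫ τ : ℝ, (1 - Real.cos (h * τ)) * |τ| ^ (-p)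
      = h ^ (p - 1) * ∫ u : ℝ, (1 - Real.cos u) * |u| ^ (-p) := by
  simp_rw [lks_g_scale p h hh]
  rw [integral_const_mul,
    Measure.integral_comp_mul_left (fun u : ℝ => (1 - Real.cos u) * |u| ^ (-p)) h]
  rw [smul_eq_mul, ← mul_assoc, abs_of_pos (by positivity), Real.rpow_sub hh, Real.rpow_one,
    div_eq_mul_inv]

theorem lks_temporal_increment_two_sided_bound
    (d : ℕ) (hd : d = 1 ∨ d = 2 ∨ d = 3) (ε ϑ T : ℝ) (hε : 0 < ε) (hT : 0 < T) :
    ∃ c₁ c₂ : ℝ, 0 < c₁ ∧ c₁ ≤ c₂ ∧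
      ∀ h : ℝ, 0 ≤ h → h ≤ T →
        c₁ * h ^ ((4 - (d : ℝ)) / 4)
          ≤ (∫ τ : ℝ, (1 - Real.cos (h * τ)) *
              ∫ ξ : EuclideanSpace ℝ (Fin d),
                (τ ^ 2 + ε ^ 2 / 64 * (-2 * ϑ + ‖ξ‖ ^ 2) ^ 4)⁻¹) ∧
        (∫ τ : ℝ, (1 - Real.cos (h * τ)) *
            ∫ ξ : EuclideanSpace ℝ (Fin d),
              (τ ^ 2 + ε ^ 2 / 64 * (-2 * ϑ + ‖ξ‖ ^ 2) ^ 4)⁻¹)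
          ≤ c₂ * h ^ ((4 - (d : ℝ)) / 4) := by
  have hd8 : d < 8 := by omega
  have hd1 : (1:ℝ) ≤ d := by exact_mod_cast (by omega : 1 ≤ d)
  have hd3 : (d:ℝ) ≤ 3 := by exact_mod_cast (by omega : d ≤ 3)
  obtain ⟨c, hcdef⟩ : ∃ c, c = ε ^ 2 / 64 := ⟨_, rfl⟩
  have hc : 0 < c := by rw [hcdef]; positivity
  obtain ⟨a, hadef⟩ : ∃ a, a = -2 * ϑ := ⟨_, rfl⟩
  obtain ⟨p, hpdef⟩ : ∃ p : ℝ, p = 2 - (d:ℝ) / 4 := ⟨_, rfl⟩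
  have hp1 : 1 < p := by linarith
  have hp2 : p < 2 := by linarith
  have hpe : (4 - (d : ℝ)) / 4 = p - 1 := by rw [hpdef]; ring
  rw [hpe, ← hcdef, ← hadef]
  set G : ℝ → ℝ := fun τ => ∫ ξ : EuclideanSpace ℝ (Fin d),
    (τ ^ 2 + c * (a + ‖ξ‖ ^ 2) ^ 4)⁻¹ with hG
  obtain ⟨H1, hH1⟩ : ∃ H1, H1 = ∫ ξ : EuclideanSpace ℝ (Fin d), (1 + (‖ξ‖ ^ 2) ^ 4)⁻¹ := ⟨_, rfl⟩
  have hH1p : 0 < H1 := hH1 ▸ lks_H_pos d hd8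
  have hHeq : ∀ τ : ℝ, τ ≠ 0 → ∫ ξ : EuclideanSpace ℝ (Fin d), (τ ^ 2 + (‖ξ‖ ^ 2) ^ 4)⁻¹
      = |τ| ^ (-p) * H1 := by
    intro τ hτ; rw [lks_H_eq d τ hτ, hH1, hpdef]
  have hGnn : ∀ τ, 0 ≤ G τ := fun τ => integral_nonneg fun ξ => by positivity
  have hGint : ∀ τ : ℝ, τ ≠ 0 → Integrable (fun ξ : EuclideanSpace ℝ (Fin d) =>
      (τ ^ 2 + c * (a + ‖ξ‖ ^ 2) ^ 4)⁻¹) := by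
    intro τ hτ
    obtain ⟨K, hK, hcmp⟩ := lks_compare c a |τ| hc (abs_pos.mpr hτ)
    refine ((lks_H_int d hd8 τ hτ).const_mul K).mono' ?_ ?_
    · refine Continuous.aestronglyMeasurable ?_
      refine Continuous.inv₀ (by fun_prop) ?_
      intro x; positivity
    · refine Filter.Eventually.of_forall fun x => ?_
      rw [Real.norm_of_nonneg (by positivity)]
      have := (hcmp τ (‖x‖ ^ 2) le_rfl).1
      rw [← div_eq_mul_inv, inv_eq_one_div, div_le_div_iff₀ (by positivity) (by positivity)]
      linarith
  obtain ⟨δ, hδdef⟩ : ∃ δ : ℝ, δ = 1 / T := ⟨_, rfl⟩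
  have hδ : 0 < δ := by rw [hδdef]; positivity
  obtain ⟨K, hK, hcmp⟩ := lks_compare c a δ hc hδ
  have hne : ∀ τ : ℝ, δ ≤ |τ| → τ ≠ 0 := fun τ h => abs_pos.mp (hδ.trans_le h)
  have hGup : ∀ τ, δ ≤ |τ| → G τ ≤ K * (|τ| ^ (-p) * H1) := by
    intro τ hτ
    have h0 := hne τ hτ
    rw [← hHeq τ h0, ← integral_const_mul]
    refine integral_mono (hGint τ h0) ((lks_H_int d hd8 τ h0).const_mul K) fun x => ?_
    have := (hcmp τ (‖x‖ ^ 2) hτ).1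
    show (_ : ℝ)⁻¹ ≤ K * (_ : ℝ)⁻¹
    rw [← div_eq_mul_inv, inv_eq_one_div, div_le_div_iff₀ (by positivity) (by positivity)]
    linarith
  have hGlow : ∀ τ, δ ≤ |τ| → K⁻¹ * (|τ| ^ (-p) * H1) ≤ G τ := by
    intro τ hτ
    have h0 := hne τ hτ
    rw [← hHeq τ h0, ← integral_const_mul]
    refine integral_mono ((lks_H_int d hd8 τ h0).const_mul _) (hGint τ h0) fun x => ?_
    have := (hcmp τ (‖x‖ ^ 2) hτ).2
    show K⁻¹ * (_ : ℝ)⁻¹ ≤ (_ : ℝ)⁻¹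
    rw [← mul_inv]
    exact inv_anti₀ (by positivity) this
  have hGsmall : ∀ τ, |τ| ≤ δ → τ ^ 2 * G τ ≤ δ ^ 2 * G δ := by
    intro τ hτ
    rcases eq_or_ne τ 0 with rfl | h0
    · have := hGnn δ
      simp only [ne_eq, OfNat.ofNat_ne_zero, not_false_eq_true, zero_pow, zero_mul]
      positivity
    rw [hG]
    simp only
    rw [← integral_const_mul, ← integral_const_mul]
    refine integral_mono ((hGint τ h0).const_mul _) ((hGint δ hδ.ne').const_mul _) fun x => ?_
    show τ ^ 2 * (_ : ℝ)⁻¹ ≤ δ ^ 2 * (_ : ℝ)⁻¹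
    have hq : 0 ≤ c * (a + ‖x‖ ^ 2) ^ 4 := by positivity
    have h2 : τ ^ 2 ≤ δ ^ 2 := by
      rw [← sq_abs τ]; exact pow_le_pow_left₀ (abs_nonneg _) hτ 2
    rw [← div_eq_mul_inv, ← div_eq_mul_inv, div_le_div_iff₀ (by positivity) (by positivity)]
    nlinarith
  have hGmeas : StronglyMeasurable G := by
    have : StronglyMeasurable (Function.uncurry fun (τ : ℝ) (ξ : EuclideanSpace ℝ (Fin d)) =>
        (τ ^ 2 + c * (a + ‖ξ‖ ^ 2) ^ 4)⁻¹) := by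
      apply Measurable.stronglyMeasurable
      unfold Function.uncurry
      fun_prop
    exact this.integral_prod_right
  obtain ⟨J, hJ⟩ : ∃ J, J = ∫ u : ℝ, (1 - Real.cos u) * |u| ^ (-p) := ⟨_, rfl⟩
  have hJnn : 0 ≤ J := by
    rw [hJ]
    refine integral_nonneg fun u => ?_
    have hc : 0 ≤ 1 - Real.cos u := by linarith [Real.cos_le_one u]
    positivity
  obtain ⟨C, hC⟩ : ∃ C, C = δ ^ 2 * G δ := ⟨_, rfl⟩
  have hCnn : 0 ≤ C := by rw [hC]; have := hGnn δ; positivity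
  have hcos1 : 0 < 1 - Real.cos 1 := by
    have := Real.cos_one_le; linarith
  have hc1 : 0 < (1 - Real.cos 1) * (K⁻¹ * (2 ^ (-p) * H1)) := by positivity
  obtain ⟨c1, hc1d⟩ : ∃ c1, c1 = (1 - Real.cos 1) * (K⁻¹ * (2 ^ (-p) * H1)) := ⟨_, rfl⟩
  have hc1p : 0 < c1 := hc1d ▸ hc1
  refine ⟨c1, c1 + (δ * C * T ^ (3 - p) + K * H1 * J), hc1p,
    by have : 0 ≤ δ * C * T ^ (3 - p) + K * H1 * J := by positivity
       linarith, ?_⟩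
  intro h hh hhT
  change c1 * h ^ (p - 1) ≤ (∫ τ : ℝ, (1 - Real.cos (h * τ)) * G τ) ∧
    (∫ τ : ℝ, (1 - Real.cos (h * τ)) * G τ) ≤ _
  rcases hh.eq_or_lt with rfl | hpos
  · have : (0:ℝ) ^ (p - 1) = 0 := Real.zero_rpow (by linarith)
    simp [this]
  have hcnn : ∀ u, 0 ≤ 1 - Real.cos u := fun u => by linarith [Real.cos_le_one u]
  set B : ℝ → ℝ := fun τ => (Set.Icc (-δ) δ).indicator (fun _ => h ^ 2 / 2 * C) τ
    + K * H1 * ((1 - Real.cos (h * τ)) * |τ| ^ (-p)) with hB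
  have hi1 : Integrable (fun τ => (Set.Icc (-δ) δ).indicator (fun _ => h ^ 2 / 2 * C) τ) := by
    refine (integrable_indicator_iff measurableSet_Icc).2 ?_
    exact integrableOn_const (by simp)
  have hi2 := (lks_gh_int p h hp1 hp2 hpos).const_mul (K * H1)
  have hBint : Integrable B := hi1.add hi2
  have hFB : ∀ τ, (1 - Real.cos (h * τ)) * G τ ≤ B τ := by
    intro τ
    have hn1 := hcnn (h * τ)
    have hn2 := hGnn τ
    rw [hB]
    simp only
    rcases le_total |τ| δ with hτ | hτ
    · rw [Set.indicator_of_mem (show τ ∈ Set.Icc (-δ) δ from abs_le.mp hτ)]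
      have h3 : (1 - Real.cos (h * τ)) * G τ ≤ h ^ 2 / 2 * C := by
        calc (1 - Real.cos (h * τ)) * G τ ≤ ((h * τ) ^ 2 / 2) * G τ := by
              gcongr; exact lks_cos_bound _
          _ = h ^ 2 / 2 * (τ ^ 2 * G τ) := by ring
          _ ≤ h ^ 2 / 2 * C := by
              rw [hC]; exact mul_le_mul_of_nonneg_left (hGsmall τ hτ) (by positivity)
      have : 0 ≤ K * H1 * ((1 - Real.cos (h * τ)) * |τ| ^ (-p)) := by positivity
      linarith
    · have h3 : (1 - Real.cos (h * τ)) * G τ ≤ K * H1 * ((1 - Real.cos (h * τ)) * |τ| ^ (-p)) := by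
        calc (1 - Real.cos (h * τ)) * G τ ≤ (1 - Real.cos (h * τ)) * (K * (|τ| ^ (-p) * H1)) :=
              mul_le_mul_of_nonneg_left (hGup τ hτ) hn1
          _ = _ := by ring
      have : 0 ≤ (Set.Icc (-δ) δ).indicator (fun _ => h ^ 2 / 2 * C) τ :=
        Set.indicator_nonneg (fun _ _ => by positivity) _
      linarith
  have hFnn : ∀ τ, 0 ≤ (1 - Real.cos (h * τ)) * G τ := fun τ => mul_nonneg (hcnn _) (hGnn _)
  have hFint : Integrable (fun τ => (1 - Real.cos (h * τ)) * G τ) := by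
    refine hBint.mono' ?_ ?_
    · exact ((by fun_prop : Measurable fun τ : ℝ => 1 - Real.cos (h * τ)).stronglyMeasurable.mul
        hGmeas).aestronglyMeasurable
    · refine Filter.Eventually.of_forall fun τ => ?_
      rw [Real.norm_of_nonneg (hFnn τ)]
      exact hFB τ
  constructor
  · have hsub : ∀ τ ∈ Set.Icc (1 / h) (2 / h), c1 * h ^ p ≤ (1 - Real.cos (h * τ)) * G τ := by
      intro τ hτ
      have l1 : 1 ≤ h * τ := by
        have := (div_le_iff₀ hpos).1 hτ.1; linarith
      have l2 : h * τ ≤ 2 := by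
        have := (le_div_iff₀ hpos).1 hτ.2; linarith
      have tp : 0 < τ := lt_of_lt_of_le (by positivity) hτ.1
      have l3 : δ ≤ |τ| := by
        rw [abs_of_pos tp, hδdef]
        exact (one_div_le_one_div_of_le hpos hhT).trans hτ.1
      have l4 : Real.cos (h * τ) ≤ Real.cos 1 :=
        Real.cos_le_cos_of_nonneg_of_le_pi (by norm_num) (by linarith [Real.pi_gt_three]) l1
      have l5 : 2 ^ (-p) * h ^ p ≤ |τ| ^ (-p) := by
        rw [abs_of_pos tp]
        calc 2 ^ (-p) * h ^ p = (2 / h) ^ (-p) := by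
              rw [Real.div_rpow (by norm_num) hpos.le, Real.rpow_neg hpos.le, div_inv_eq_mul]
          _ ≤ τ ^ (-p) := Real.rpow_le_rpow_of_nonpos tp hτ.2 (by linarith)
      calc c1 * h ^ p = (1 - Real.cos 1) * (K⁻¹ * ((2 ^ (-p) * h ^ p) * H1)) := by rw [hc1d]; ring
        _ ≤ (1 - Real.cos (h * τ)) * (K⁻¹ * (|τ| ^ (-p) * H1)) := by
            apply mul_le_mul (by linarith) _ (by positivity) (hcnn _)
            gcongr
        _ ≤ _ := mul_le_mul_of_nonneg_left (hGlow τ l3) (hcnn _)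
    calc c1 * h ^ (p - 1) = ∫ τ in Set.Icc (1 / h) (2 / h), c1 * h ^ p := by
          rw [setIntegral_const, Measure.real, Real.volume_Icc, ENNReal.toReal_ofReal]
          · rw [smul_eq_mul, Real.rpow_sub hpos, Real.rpow_one]; field_simp; ring
          · rw [← sub_div]; norm_num; exact hpos.le
      _ ≤ ∫ τ in Set.Icc (1 / h) (2 / h), (1 - Real.cos (h * τ)) * G τ :=
          setIntegral_mono_on (integrableOn_const (by simp)) hFint.integrableOn
            measurableSet_Icc hsub
      _ ≤ _ := setIntegral_le_integral hFint (Filter.Eventually.of_forall hFnn)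
  · have hBv : ∫ τ, B τ = δ * C * h ^ 2 + K * H1 * J * h ^ (p - 1) := by
      rw [hB, integral_add hi1 hi2, integral_const_mul, lks_gh_eq p h hpos, ← hJ,
        integral_indicator measurableSet_Icc, setIntegral_const, Measure.real, Real.volume_Icc,
        ENNReal.toReal_ofReal (by linarith), smul_eq_mul]
      ring
    have hh2 : h ^ 2 ≤ T ^ (3 - p) * h ^ (p - 1) := by
      calc h ^ 2 = h ^ (3 - p) * h ^ (p - 1) := by
            rw [← Real.rpow_add hpos, ← Real.rpow_two]; congr 1; ring
        _ ≤ _ := by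
            gcongr
            linarith
    calc _ ≤ ∫ τ, B τ := integral_mono hFint hBint hFB
      _ = δ * C * h ^ 2 + K * H1 * J * h ^ (p - 1) := hBv
      _ ≤ δ * C * (T ^ (3 - p) * h ^ (p - 1)) + K * H1 * J * h ^ (p - 1) := by gcongr
      _ ≤ _ := by
          have : 0 ≤ c1 * h ^ (p - 1) := by positivity
          linarith
end

section
/- Let d ∈ {1,2,3} and ε > 0. For all s, t with 0 ≤ s ≤ t, (2π)^{-d} ∫_0^s ∫_{ℝ^d} exp(-(ε(t+s−2r)/8)·|ξ|⁴) dξ dr = [ (2π)^{-d} (8/ε)^{d/4} (2 − d/2)^{-1} ∫_{ℝ^d} e^{-|ξ|⁴} dξ ] · [ (t+s)^{1 − d/4} − (t−s)^{1 − d/4} ]. -/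
open MeasureTheory Real

theorem lks_scaling (d : ℕ) (c : ℝ) (hc : 0 < c) :
    ∫ ξ : EuclideanSpace ℝ (Fin d), Real.exp (-c * ‖ξ‖ ^ 4)
      = c ^ (-((d : ℝ) / 4)) * ∫ ξ : EuclideanSpace ℝ (Fin d), Real.exp (-‖ξ‖ ^ 4) := by
  have hR : 0 < c ^ ((1 : ℝ) / 4) := Real.rpow_pos_of_pos hc _
  have h4 : (c ^ ((1 : ℝ) / 4)) ^ 4 = c := by
    rw [← Real.rpow_natCast, ← Real.rpow_mul hc.le]; norm_num
  have h := Measure.integral_comp_smul (volume : Measure (EuclideanSpace ℝ (Fin d)))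
    (fun ξ => Real.exp (-‖ξ‖ ^ 4)) (c ^ ((1 : ℝ) / 4))
  simp only [norm_smul, mul_pow, Real.norm_eq_abs, abs_of_pos hR, h4, finrank_euclideanSpace,
    Fintype.card_fin, smul_eq_mul] at h
  simp only [neg_mul]
  rw [h, abs_of_pos (by positivity), ← Real.rpow_natCast, ← Real.rpow_mul hc.le,
    ← Real.rpow_neg hc.le]
  congr 2
  ring

/-- Temporal covariance of the linear L-KS SPDE with `ϑ = 0` is, up to a constant,
that of a bifractional Brownian motion with `H = 1/2`, `K = 1 − d/4`:
`(2π)^{-d} ∫₀^s ∫ e^{-(ε(t+s−2r)/8)|ξ|⁴} dξ dr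
  = [(2π)^{-d} (8/ε)^{d/4} (2−d/2)⁻¹ ∫ e^{-|ξ|⁴} dξ] ((t+s)^{1−d/4} − (t−s)^{1−d/4})`. -/
theorem lks_bifractional_covariance
    (d : ℕ) (hd : d = 1 ∨ d = 2 ∨ d = 3) (ε : ℝ) (hε : 0 < ε)
    (s t : ℝ) (hs : 0 ≤ s) (hst : s ≤ t) :
    (2 * π) ^ (-(d : ℝ)) *
      (∫ r in (0 : ℝ)..s, ∫ ξ : EuclideanSpace ℝ (Fin d),
        Real.exp (-(ε * (t + s - 2 * r) / 8) * ‖ξ‖ ^ 4))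
    = ((2 * π) ^ (-(d : ℝ)) * (8 / ε) ^ ((d : ℝ) / 4) * (2 - (d : ℝ) / 2)⁻¹ *
        ∫ ξ : EuclideanSpace ℝ (Fin d), Real.exp (-‖ξ‖ ^ 4)) *
      ((t + s) ^ (1 - (d : ℝ) / 4) - (t - s) ^ (1 - (d : ℝ) / 4)) := by
  have hd4 : (d : ℝ) < 4 := by rcases hd with h | h | h <;> subst h <;> norm_num
  have key := intervalIntegral.integral_comp_sub_mul (a := 0) (b := s)
    (fun u : ℝ => ∫ ξ : EuclideanSpace ℝ (Fin d), Real.exp (-(ε * u / 8) * ‖ξ‖ ^ 4))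
    (two_ne_zero) (t + s)
  have h2 : ∫ u in (t - s)..(t + s),
      (∫ ξ : EuclideanSpace ℝ (Fin d), Real.exp (-(ε * u / 8) * ‖ξ‖ ^ 4))
      = ∫ u in (t - s)..(t + s), ((8 / ε) ^ ((d : ℝ) / 4) *
        ∫ ξ : EuclideanSpace ℝ (Fin d), Real.exp (-‖ξ‖ ^ 4)) * u ^ (-((d : ℝ) / 4)) := by
    rw [intervalIntegral.integral_of_le (by linarith), intervalIntegral.integral_of_le (by linarith)]
    refine setIntegral_congr_fun measurableSet_Ioc fun u hu => ?_
    have hu0 : 0 < u := by linarith [hu.1]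
    rw [lks_scaling d (ε * u / 8) (by positivity),
      show ε * u / 8 = (8 / ε)⁻¹ * u by field_simp,
      Real.mul_rpow (by positivity) hu0.le, Real.inv_rpow (by positivity),
      ← Real.rpow_neg (by positivity), neg_neg]
    ring
  rw [key, show t + s - 2 * s = t - s by ring, show t + s - 2 * 0 = t + s by ring, h2,
    intervalIntegral.integral_const_mul, integral_rpow (Or.inl (by linarith)),
    show -((d : ℝ) / 4) + 1 = 1 - (d : ℝ) / 4 by ring,
    show (2 - (d : ℝ) / 2) = 2 * (1 - (d : ℝ) / 4) by ring, mul_inv, smul_eq_mul]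
  ring
end

section
/- Fix d ∈ {1,2,3}, ε > 0, ϑ ∈ ℝ and t > 0, and let S(ξ) = (4/(ε(2π)^d)) · (1 − exp(-(εt/4)·(-2ϑ+|ξ|²)²)) / (-2ϑ+|ξ|²)², extended by continuity where -2ϑ+|ξ|² = 0. Then lim_{|ξ| → ∞} |ξ|⁴ · S(ξ) = 4/(ε(2π)^d); in particular S(ξ) is asymptotically equivalent to (4/(ε(2π)^d)) · |ξ|^{-(d + 2γ₂)} with γ₂ = 2 − d/2 as |ξ| → ∞. -/
open MeasureTheory Real Filter Asymptotics

/-- Asymptotics of the spatial spectral density of the linear L-KS SPDE at a fixed time: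
`|ξ|⁴ S(ξ) → 4/(ε(2π)^d)` as `|ξ| → ∞`; in particular `S(ξ) ∼ (4/(ε(2π)^d)) |ξ|^{-(d+2γ₂)}`
with `γ₂ = 2 − d/2`.  Here `S(ξ) = (4/(ε(2π)^d)) (1 − e^{-(εt/4)(-2ϑ+|ξ|²)²})/(-2ϑ+|ξ|²)²`,
extended by continuity (value `(4/(ε(2π)^d))(εt/4)`) where `-2ϑ+|ξ|² = 0`. -/
theorem lks_spatial_spectral_density_asymptotics
    (d : ℕ) (hd : d = 1 ∨ d = 2 ∨ d = 3) (ε ϑ t : ℝ) (hε : 0 < ε) (ht : 0 < t)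
    (S : EuclideanSpace ℝ (Fin d) → ℝ)
    (hS : ∀ ξ : EuclideanSpace ℝ (Fin d),
      S ξ = 4 / (ε * (2 * π) ^ d) *
        (if -2 * ϑ + ‖ξ‖ ^ 2 = 0 then ε * t / 4
         else (1 - Real.exp (-(ε * t / 4) * (-2 * ϑ + ‖ξ‖ ^ 2) ^ 2)) /
                (-2 * ϑ + ‖ξ‖ ^ 2) ^ 2)) :
    Tendsto (fun ξ : EuclideanSpace ℝ (Fin d) => ‖ξ‖ ^ 4 * S ξ)
      (Filter.comap (fun ξ : EuclideanSpace ℝ (Fin d) => ‖ξ‖) atTop)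
      (nhds (4 / (ε * (2 * π) ^ d))) ∧
    S ~[Filter.comap (fun ξ : EuclideanSpace ℝ (Fin d) => ‖ξ‖) atTop]
      (fun ξ : EuclideanSpace ℝ (Fin d) =>
        4 / (ε * (2 * π) ^ d) * ‖ξ‖ ^ (-((d : ℝ) + 2 * (2 - (d : ℝ) / 2)))) := by
  set C : ℝ := 4 / (ε * (2 * π) ^ d) with hC
  have hCpos : 0 < C := by positivity
  set l := Filter.comap (fun ξ : EuclideanSpace ℝ (Fin d) => ‖ξ‖) atTop with hl
  have hr : Tendsto (fun ξ : EuclideanSpace ℝ (Fin d) => ‖ξ‖) l atTop := tendsto_comap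
  have hq : Tendsto (fun ξ : EuclideanSpace ℝ (Fin d) => -2 * ϑ + ‖ξ‖ ^ 2) l atTop :=
    tendsto_atTop_add_const_left _ _ ((tendsto_pow_atTop two_ne_zero).comp hr)
  have hexp : Tendsto (fun q : ℝ => Real.exp (-(ε * t / 4) * q ^ 2)) atTop (nhds 0) := by
    apply Real.tendsto_exp_atBot.comp
    have hc : -(ε * t / 4) < 0 := by
      have : 0 < ε * t / 4 := by positivity
      linarith
    exact (tendsto_pow_atTop two_ne_zero).const_mul_atTop_of_neg hc
  have hinv : Tendsto (fun q : ℝ => 2 * ϑ / q) atTop (nhds 0) :=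
    tendsto_const_nhds.div_atTop tendsto_id
  have hmain : Tendsto (fun q : ℝ =>
      C * ((1 - Real.exp (-(ε * t / 4) * q ^ 2)) * (1 + 2 * ϑ / q) ^ 2)) atTop (nhds C) := by
    have := ((hexp.const_sub 1).mul ((hinv.const_add 1).pow 2)).const_mul C
    simpa using this
  have h1 : Tendsto (fun ξ : EuclideanSpace ℝ (Fin d) => ‖ξ‖ ^ 4 * S ξ) l (nhds C) := by
    refine (hmain.comp hq).congr' ?_
    filter_upwards [hq.eventually_gt_atTop 0] with ξ hξ
    rw [hS ξ, if_neg hξ.ne']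
    simp only [Function.comp]
    have e : ‖ξ‖ ^ 4 = ((-2 * ϑ + ‖ξ‖ ^ 2) + 2 * ϑ) ^ 2 := by ring
    rw [e]
    generalize -2 * ϑ + ‖ξ‖ ^ 2 = q at hξ ⊢
    have hq0 : q ≠ 0 := hξ.ne'
    field_simp
  refine ⟨h1, ?_⟩
  have hpow : ∀ ξ : EuclideanSpace ℝ (Fin d),
      ‖ξ‖ ^ (-((d : ℝ) + 2 * (2 - (d : ℝ) / 2))) = (‖ξ‖ ^ 4)⁻¹ := by
    intro ξ
    have e : -((d : ℝ) + 2 * (2 - (d : ℝ) / 2)) = -((4 : ℕ) : ℝ) := by push_cast; ring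
    rw [e, Real.rpow_neg (norm_nonneg _), Real.rpow_natCast]
  simp only [hpow]
  have hpos := hr.eventually_gt_atTop 0
  rw [isEquivalent_iff_tendsto_one]
  · have h2 := h1.div_const C
    rw [div_self hCpos.ne'] at h2
    refine h2.congr' ?_
    filter_upwards [hpos] with ξ hξ
    simp only [Pi.div_apply]
    field_simp
  · filter_upwards [hpos] with ξ hξ
    positivity
end

section
/- Fix ε > 0, ϑ ∈ ℝ, t > 0 and M > 0, and let S(ξ) = (4/(2πε)) · (1 − exp(-(εt/4)·(-2ϑ+ξ²)²)) / (-2ϑ+ξ²)² for ξ ∈ ℝ, extended by continuity where -2ϑ+ξ² = 0. Then there exist constants 0 < c₁ ≤ c₂ < ∞ such that for all x, y ∈ [-M, M], c₁·|x−y| ≤ ∫_ℝ ξ² (1 − cos(ξ(x−y))) S(ξ) dξ ≤ c₂·|x−y|. -/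
open MeasureTheory Real

lemma aux_ratio (a q s : ℝ) (ha : 0 < a)
    (hs : s = if q = 0 then a else (1 - Real.exp (-a * q ^ 2)) / q ^ 2) :
    s ≤ a ∧ q ^ 2 * s ≤ 1 ∧ a / (1 + a * q ^ 2) ≤ s := by
  by_cases h : q = 0
  · simp [h] at hs
    subst hs; simp [h]
  · simp only [h, if_false] at hs
    have hq : 0 < q ^ 2 := by positivity
    have h1 := Real.add_one_le_exp (-a * q ^ 2)
    have h2 := Real.add_one_le_exp (a * q ^ 2)
    have h3 := Real.exp_pos (-a * q ^ 2)
    have h4 : Real.exp (-a * q ^ 2) * Real.exp (a * q ^ 2) = 1 := by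
      rw [← Real.exp_add]; simp
    have haq : 0 < a * q ^ 2 := by positivity
    subst hs
    refine ⟨?_, ?_, ?_⟩
    · rw [div_le_iff₀ hq]; linarith
    · rw [mul_div_cancel₀ _ hq.ne']; linarith
    · rw [div_le_div_iff₀ (by positivity) hq]
      nlinarith

lemma aux_cos (u : ℝ) : 1 - Real.cos u ≤ 4 * u ^ 2 / (1 + u ^ 2) := by
  rw [le_div_iff₀ (by positivity)]
  have h1 := Real.one_sub_sq_div_two_le_cos (x := u)
  have h2 := Real.neg_one_le_cos u
  rcases le_total (u ^ 2) 1 with h | h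
  · nlinarith [sq_nonneg u]
  · nlinarith [sq_nonneg u]

lemma aux_int (b h : ℝ) (hb : 0 < b) (hh : 0 < h) :
    (b - 2) / h ≤ ∫ ξ in Set.Ioc (b / h) (2 * b / h), (1 - Real.cos (ξ * h)) := by
  have hle : b / h ≤ 2 * b / h := by gcongr; linarith
  rw [← intervalIntegral.integral_of_le hle, intervalIntegral.integral_sub (by simp)
    (Continuous.intervalIntegrable (by fun_prop) _ _),
    intervalIntegral.integral_comp_mul_right (fun x => Real.cos x) hh.ne', integral_cos]
  simp only [intervalIntegral.integral_const, smul_eq_mul]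
  rw [div_mul_cancel₀ _ hh.ne', div_mul_cancel₀ _ hh.ne']
  have h1 := Real.sin_le_one (2 * b)
  have h2 := Real.neg_one_le_sin b
  have : (2 * b / h - b / h) * 1 - h⁻¹ * (Real.sin (2 * b) - Real.sin b)
      = (b - (Real.sin (2 * b) - Real.sin b)) / h := by field_simp; ring
  rw [this]
  gcongr
  linarith

lemma aux_upper (S : ℝ → ℝ) (hm : Measurable S) (K h : ℝ) (hS0 : ∀ ξ, 0 ≤ S ξ)
    (hK : ∀ ξ, ξ ^ 4 * S ξ ≤ K) (hh : 0 < h) :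
    Integrable (fun ξ : ℝ => ξ ^ 2 * (1 - Real.cos (ξ * h)) * S ξ) ∧
    (∫ ξ : ℝ, ξ ^ 2 * (1 - Real.cos (ξ * h)) * S ξ) ≤ 4 * K * π * h := by
  have hgi : Integrable (fun ξ : ℝ => 4 * K * h ^ 2 * (1 + (ξ * h) ^ 2)⁻¹) :=
    (integrable_inv_one_add_sq.comp_mul_right' hh.ne').const_mul _
  have hb : ∀ ξ : ℝ, ξ ^ 2 * (1 - Real.cos (ξ * h)) * S ξ ≤
      4 * K * h ^ 2 * (1 + (ξ * h) ^ 2)⁻¹ := by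
    intro ξ
    calc ξ ^ 2 * (1 - Real.cos (ξ * h)) * S ξ
        ≤ ξ ^ 2 * (4 * (ξ * h) ^ 2 / (1 + (ξ * h) ^ 2)) * S ξ := by
          have := hS0 ξ
          gcongr
          exact aux_cos _
      _ = 4 * (ξ ^ 4 * S ξ) * h ^ 2 * (1 + (ξ * h) ^ 2)⁻¹ := by
          rw [div_eq_mul_inv]; ring
      _ ≤ _ := by
          gcongr
          exact hK ξ
  have h0 : ∀ ξ : ℝ, 0 ≤ ξ ^ 2 * (1 - Real.cos (ξ * h)) * S ξ := fun ξ =>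
    mul_nonneg (mul_nonneg (sq_nonneg _) (by linarith [Real.cos_le_one (ξ * h)])) (hS0 ξ)
  have hi : Integrable (fun ξ : ℝ => ξ ^ 2 * (1 - Real.cos (ξ * h)) * S ξ) := by
    refine hgi.mono' (by fun_prop) (Filter.Eventually.of_forall fun ξ => ?_)
    rw [Real.norm_of_nonneg (h0 ξ)]
    exact hb ξ
  refine ⟨hi, (integral_mono hi hgi hb).trans (le_of_eq ?_)⟩
  rw [integral_const_mul, Measure.integral_comp_mul_right (fun x : ℝ => (1 + x ^ 2)⁻¹) h,
    integral_univ_inv_one_add_sq, abs_of_pos (by positivity), smul_eq_mul]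
  field_simp

lemma aux_lower (S : ℝ → ℝ) (k h b : ℝ) (hS0 : ∀ ξ, 0 ≤ S ξ) (hk0 : 0 ≤ k)
    (hk : ∀ ξ, 1 ≤ ξ → k ≤ ξ ^ 4 * S ξ) (hh : 0 < h) (hb : 3 ≤ b) (hhb : h ≤ b)
    (hi : Integrable (fun ξ : ℝ => ξ ^ 2 * (1 - Real.cos (ξ * h)) * S ξ)) :
    k / (4 * b ^ 2) * h ≤ ∫ ξ : ℝ, ξ ^ 2 * (1 - Real.cos (ξ * h)) * S ξ := by
  have h0 : ∀ ξ : ℝ, 0 ≤ ξ ^ 2 * (1 - Real.cos (ξ * h)) * S ξ := fun ξ =>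
    mul_nonneg (mul_nonneg (sq_nonneg _) (by linarith [Real.cos_le_one (ξ * h)])) (hS0 ξ)
  have h1 := setIntegral_le_integral (s := Set.Ioc (b / h) (2 * b / h)) hi
    (Filter.Eventually.of_forall h0)
  refine le_trans ?_ h1
  have h2 : (∫ ξ in Set.Ioc (b / h) (2 * b / h), k * h ^ 2 / (4 * b ^ 2) *
      (1 - Real.cos (ξ * h))) ≤
      ∫ ξ in Set.Ioc (b / h) (2 * b / h), ξ ^ 2 * (1 - Real.cos (ξ * h)) * S ξ := by
    refine setIntegral_mono_on ?_ hi.integrableOn measurableSet_Ioc ?_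
    · exact (Continuous.integrableOn_Icc (by fun_prop)).mono_set Set.Ioc_subset_Icc_self
    · intro ξ hξ
      have hξ1 : 1 ≤ ξ := le_trans ((one_le_div hh).2 hhb) hξ.1.le
      have hξ2 : ξ * h ≤ 2 * b := (le_div_iff₀ hh).1 hξ.2
      have hc : 0 ≤ 1 - Real.cos (ξ * h) := by linarith [Real.cos_le_one (ξ * h)]
      have : k * h ^ 2 / (4 * b ^ 2) ≤ ξ ^ 2 * S ξ := by
        rw [div_le_iff₀ (by positivity)]
        have e1 : (ξ * h) ^ 2 ≤ 4 * b ^ 2 := by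
          have : (ξ * h) ^ 2 ≤ (2 * b) ^ 2 := by gcongr
          linarith
        have := hS0 ξ
        calc k * h ^ 2 ≤ ξ ^ 4 * S ξ * h ^ 2 := by
              gcongr
              exact hk ξ hξ1
          _ = ξ ^ 2 * S ξ * (ξ * h) ^ 2 := by ring
          _ ≤ _ := by gcongr
      calc _ ≤ ξ ^ 2 * S ξ * (1 - Real.cos (ξ * h)) := by gcongr
        _ = _ := by ring
  refine le_trans ?_ h2
  rw [integral_const_mul]
  calc k / (4 * b ^ 2) * h = k * h ^ 2 / (4 * b ^ 2) * (1 / h) := by field_simp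
    _ ≤ k * h ^ 2 / (4 * b ^ 2) * ((b - 2) / h) := by
        gcongr
        linarith
    _ ≤ _ := by
        gcongr
        exact aux_int b h (by linarith) hh

/-- Two-sided bound for the squared L² spatial increments of the gradient of the linear
L-KS SPDE in dimension `d = 1`: for all `x, y ∈ [-M,M]`,
`c₁|x−y| ≤ ∫ ξ² (1 − cos(ξ(x−y))) S(ξ) dξ ≤ c₂|x−y|`, where `S` is the spatial spectral
density, extended by continuity (value `εt/4` for the ratio) where `-2ϑ+ξ² = 0`. -/
theorem lks_gradient_spatial_increment_two_sided_bound
    (ε ϑ t M : ℝ) (hε : 0 < ε) (ht : 0 < t) (hM : 0 < M)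
    (S : ℝ → ℝ)
    (hS : ∀ ξ : ℝ,
      S ξ = 4 / (2 * π * ε) *
        (if -2 * ϑ + ξ ^ 2 = 0 then ε * t / 4
         else (1 - Real.exp (-(ε * t / 4) * (-2 * ϑ + ξ ^ 2) ^ 2)) /
                (-2 * ϑ + ξ ^ 2) ^ 2)) :
    ∃ c₁ c₂ : ℝ, 0 < c₁ ∧ c₁ ≤ c₂ ∧
      ∀ x y : ℝ, x ∈ Set.Icc (-M) M → y ∈ Set.Icc (-M) M →
        c₁ * |x - y| ≤ (∫ ξ : ℝ, ξ ^ 2 * (1 - Real.cos (ξ * (x - y))) * S ξ) ∧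
        (∫ ξ : ℝ, ξ ^ 2 * (1 - Real.cos (ξ * (x - y))) * S ξ) ≤ c₂ * |x - y| := by
  set a := ε * t / 4 with ha_def
  have ha : 0 < a := by positivity
  set A := 4 / (2 * π * ε) with hA_def
  have hA : 0 < A := by positivity
  have hr := fun ξ : ℝ => aux_ratio a (-2 * ϑ + ξ ^ 2) _ ha rfl
  have hm : Measurable S := by
    rw [funext hS]
    refine Measurable.const_mul (Measurable.ite ?_ (by fun_prop) (by fun_prop)) _
    exact measurableSet_eq_fun (by fun_prop) (by fun_prop)
  have hS0 : ∀ ξ, 0 ≤ S ξ := by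
    intro ξ
    rw [hS]
    exact mul_nonneg hA.le (le_trans (by positivity) (hr ξ).2.2)
  have hK : ∀ ξ, ξ ^ 4 * S ξ ≤ A * (2 + 8 * ϑ ^ 2 * a) := by
    intro ξ
    have h0 := hS0 ξ
    have h1 := (hr ξ).1
    have h2 := (hr ξ).2.1
    have h3 := le_trans (by positivity) (hr ξ).2.2
    rw [hS]
    generalize (if -2 * ϑ + ξ ^ 2 = 0 then a else _ : ℝ) = s at *
    have h4 : ξ ^ 4 ≤ 2 * (-2 * ϑ + ξ ^ 2) ^ 2 + 8 * ϑ ^ 2 := by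
      nlinarith [sq_nonneg (ξ ^ 2 - 4 * ϑ)]
    have h5 : ξ ^ 4 * s ≤ 2 + 8 * ϑ ^ 2 * a := by
      nlinarith [mul_le_mul_of_nonneg_right h4 h3,
        mul_le_mul_of_nonneg_left h1 (by positivity : 0 ≤ 8 * ϑ ^ 2)]
    nlinarith
  set k := A * (a / (1 + a * (2 + 8 * ϑ ^ 2))) with hk_def
  have hk0 : 0 < k := by positivity
  have hk : ∀ ξ, 1 ≤ ξ → k ≤ ξ ^ 4 * S ξ := by
    intro ξ hξ
    have h3 := (hr ξ).2.2
    rw [hS]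
    generalize (if -2 * ϑ + ξ ^ 2 = 0 then a else _ : ℝ) = s at *
    have h6 : 1 ≤ ξ ^ 4 := one_le_pow₀ hξ
    have h4 : 1 + a * (-2 * ϑ + ξ ^ 2) ^ 2 ≤ ξ ^ 4 * (1 + a * (2 + 8 * ϑ ^ 2)) := by
      have : (-2 * ϑ + ξ ^ 2) ^ 2 ≤ ξ ^ 4 * (2 + 8 * ϑ ^ 2) := by
        nlinarith [sq_nonneg (ξ ^ 2 + 2 * ϑ), sq_nonneg ϑ]
      nlinarith
    have h5 : a / (1 + a * (2 + 8 * ϑ ^ 2)) ≤ ξ ^ 4 * s := by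
      refine le_trans ?_ (mul_le_mul_of_nonneg_left h3 (by positivity))
      rw [← mul_div_assoc, div_le_div_iff₀ (by positivity) (by positivity)]
      nlinarith
    calc k ≤ A * (ξ ^ 4 * s) := by rw [hk_def]; gcongr
      _ = _ := by ring
  have key : ∀ h, 0 < h → h ≤ 2 * M → _ := fun h hh hhM =>
    have u := aux_upper S hm _ h hS0 hK hh
    And.intro (aux_lower S k h (2 * M + 3) hS0 hk0.le hk hh (by linarith) (by linarith) u.1) u.2
  refine ⟨k / (4 * (2 * M + 3) ^ 2), 4 * (A * (2 + 8 * ϑ ^ 2 * a)) * π, by positivity, ?_, ?_⟩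
  · have := key (2 * M) (by linarith) le_rfl
    exact le_of_mul_le_mul_right (this.1.trans this.2) (by linarith : 0 < 2 * M)
  · intro x y hx hy
    by_cases hxy : x = y
    · simp [hxy]
    have := key |x - y| (abs_pos.2 (sub_ne_zero.2 hxy))
      (abs_le.2 ⟨by linarith [hx.1, hy.2], by linarith [hx.2, hy.1]⟩)
    have hc : ∀ ξ : ℝ, Real.cos (ξ * |x - y|) = Real.cos (ξ * (x - y)) := by
      intro ξ
      rcases abs_choice (x - y) with e | e <;> rw [e]
      rw [mul_neg, Real.cos_neg]
    simpa only [hc] using this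
end

section
/- Fix ε > 0, ϑ ∈ ℝ, t > 0 and M > 0, and let S(ξ) = (4/(ε(2π)³)) · (1 − exp(-(εt/4)·(-2ϑ+|ξ|²)²)) / (-2ϑ+|ξ|²)² for ξ ∈ ℝ³, extended by continuity where -2ϑ+|ξ|² = 0. Then there exist constants 0 < c₁ ≤ c₂ < ∞ such that for all x, y ∈ [-M, M]³, c₁·|x−y| ≤ ∫_{ℝ³} (1 − cos(⟨ξ, x−y⟩)) S(ξ) dξ ≤ c₂·|x−y|. -/
open MeasureTheory Real
open scoped RealInnerProductSpace

lemma lks_F_bounds (A u F : ℝ) (hA : 0 < A)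
    (hF : F = if u = 0 then A else (1 - Real.exp (-A * u ^ 2)) / u ^ 2) :
    0 ≤ F ∧ F * u ^ 2 ≤ 1 ∧ F ≤ A ∧ A ≤ F * (1 + A * u ^ 2) := by
  by_cases h : u = 0
  · subst h
    simp at hF
    subst hF
    refine ⟨hA.le, by simp, le_rfl, by simp⟩
  · rw [if_neg h] at hF
    have hu : 0 < u ^ 2 := by positivity
    have h1 : F * u ^ 2 = 1 - Real.exp (-A * u ^ 2) := by
      rw [hF]; field_simp
    have h2 := Real.exp_pos (-A * u ^ 2)
    have h3 := Real.add_one_le_exp (-A * u ^ 2)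
    have h4 := Real.add_one_le_exp (A * u ^ 2)
    have h5 : Real.exp (-A * u ^ 2) * Real.exp (A * u ^ 2) = 1 := by
      rw [← Real.exp_add]; simp
    have h6 : Real.exp (-A * u ^ 2) * (A * u ^ 2 + 1) ≤ 1 := by
      exact (mul_le_mul_of_nonneg_left h4 h2.le).trans h5.le
    have h7 : 0 < A * u ^ 2 := by positivity
    refine ⟨?_, by linarith, ?_, ?_⟩
    · rw [hF]
      apply div_nonneg _ hu.le
      have : Real.exp (-A * u ^ 2) ≤ 1 := Real.exp_le_one_iff.2 (by linarith)
      linarith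
    · refine le_of_mul_le_mul_right ?_ hu
      linarith
    · refine le_of_mul_le_mul_right ?_ hu
      have : F * (1 + A * u ^ 2) * u ^ 2 = (F * u ^ 2) * (1 + A * u ^ 2) := by ring
      rw [this, h1]
      nlinarith

lemma lks_H_int_s10 : Integrable (fun η : EuclideanSpace ℝ (Fin 3) =>
    min 2 (‖η‖ ^ 2 / 2) / ‖η‖ ^ 4) := by
  rw [MeasureTheory.integrable_fun_norm_addHaar volume
    (f := fun r : ℝ => min 2 (r ^ 2 / 2) / r ^ 4)]
  have h0 : Integrable (fun y : ℝ => (5 / 2) * (1 + y ^ 2)⁻¹) :=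
    integrable_inv_one_add_sq.const_mul _
  refine Integrable.mono' h0.integrableOn ?_ ?_
  · apply Measurable.aestronglyMeasurable
    simp only [smul_eq_mul]
    fun_prop
  · filter_upwards [ae_restrict_mem measurableSet_Ioi] with y hy
    have hy : 0 < y := hy
    simp only [finrank_euclideanSpace, Fintype.card_fin, smul_eq_mul]
    have hm : 0 ≤ min 2 (y ^ 2 / 2) := le_min (by norm_num) (by positivity)
    rw [Real.norm_of_nonneg (by positivity)]
    have e : y ^ (3 - 1) * (min 2 (y ^ 2 / 2) / y ^ 4) = min 2 (y ^ 2 / 2) / y ^ 2 := by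
      norm_num
      field_simp
    rw [e, ← div_eq_mul_inv, div_le_div_iff₀ (by positivity) (by positivity)]
    have a := min_le_left 2 (y ^ 2 / 2)
    have b := min_le_right 2 (y ^ 2 / 2)
    have := mul_le_mul_of_nonneg_right a (sq_nonneg y)
    linarith

/-- Two-sided bound for the squared L² spatial increments of the linear L-KS SPDE in
dimension `d = 3`: for all `x, y ∈ [-M,M]³`,
`c₁|x−y| ≤ ∫ (1 − cos⟨ξ, x−y⟩) S(ξ) dξ ≤ c₂|x−y|`, where `S` is the spatial spectral
density, extended by continuity (value `εt/4` for the ratio) where `-2ϑ+|ξ|² = 0`. -/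
theorem lks_spatial_increment_two_sided_bound_dim3
    (ε ϑ t M : ℝ) (hε : 0 < ε) (ht : 0 < t) (hM : 0 < M)
    (S : EuclideanSpace ℝ (Fin 3) → ℝ)
    (hS : ∀ ξ : EuclideanSpace ℝ (Fin 3),
      S ξ = 4 / (ε * (2 * π) ^ 3) *
        (if -2 * ϑ + ‖ξ‖ ^ 2 = 0 then ε * t / 4
         else (1 - Real.exp (-(ε * t / 4) * (-2 * ϑ + ‖ξ‖ ^ 2) ^ 2)) /
                (-2 * ϑ + ‖ξ‖ ^ 2) ^ 2)) :
    ∃ c₁ c₂ : ℝ, 0 < c₁ ∧ c₁ ≤ c₂ ∧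
      ∀ x y : EuclideanSpace ℝ (Fin 3),
        (∀ i, x i ∈ Set.Icc (-M) M) → (∀ i, y i ∈ Set.Icc (-M) M) →
          c₁ * ‖x - y‖
              ≤ (∫ ξ : EuclideanSpace ℝ (Fin 3), (1 - Real.cos ⟪ξ, x - y⟫) * S ξ) ∧
          (∫ ξ : EuclideanSpace ℝ (Fin 3), (1 - Real.cos ⟪ξ, x - y⟫) * S ξ)
              ≤ c₂ * ‖x - y‖ := by
  set A := ε * t / 4 with hAdef
  have hA : 0 < A := by positivity
  set P := 4 / (ε * (2 * π) ^ 3) with hP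
  have hPpos : 0 < P := by positivity
  have hSm : Measurable S := by
    have : S = fun ξ => _ := funext hS
    rw [this]
    refine Measurable.const_mul (Measurable.ite ?_ ?_ ?_) _
    · exact measurableSet_eq_fun (by fun_prop) (by fun_prop)
    · fun_prop
    · fun_prop
  have hS0 : ∀ ξ, 0 ≤ S ξ := fun ξ => by
    rw [hS]
    exact mul_nonneg hPpos.le (lks_F_bounds A _ _ hA rfl).1
  set K := P * (2 + 8 * ϑ ^ 2 * A) with hK
  have hKpos : 0 < K := by positivity
  have hSup : ∀ ξ, S ξ * ‖ξ‖ ^ 4 ≤ K := fun ξ => by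
    obtain ⟨h1, h2, h3, h4⟩ := lks_F_bounds A (-2 * ϑ + ‖ξ‖ ^ 2) _ hA rfl
    rw [hS, hK, mul_assoc]
    refine mul_le_mul_of_nonneg_left ?_ hPpos.le
    generalize (if -2 * ϑ + ‖ξ‖ ^ 2 = 0 then A
      else (1 - Real.exp (-A * (-2 * ϑ + ‖ξ‖ ^ 2) ^ 2)) / (-2 * ϑ + ‖ξ‖ ^ 2) ^ 2) = F at *
    have : ‖ξ‖ ^ 4 ≤ 2 * (-2 * ϑ + ‖ξ‖ ^ 2) ^ 2 + 8 * ϑ ^ 2 := by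
      nlinarith [sq_nonneg (‖ξ‖ ^ 2 - 4 * ϑ)]
    have h5 := mul_le_mul_of_nonneg_left this h1
    have h6 := mul_le_mul_of_nonneg_left h3 (by positivity : 0 ≤ 8 * ϑ ^ 2)
    linarith
  set B := 1 + 8 * ϑ ^ 2 * A + 2 * A with hB
  have hBpos : 0 < B := by positivity
  have hSlow : ∀ ξ, P * A ≤ S ξ * (B * (1 + ‖ξ‖ ^ 4)) := fun ξ => by
    obtain ⟨h1, h2, h3, h4⟩ := lks_F_bounds A (-2 * ϑ + ‖ξ‖ ^ 2) _ hA rfl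
    rw [hS, mul_assoc]
    refine mul_le_mul_of_nonneg_left (h4.trans ?_) hPpos.le
    refine mul_le_mul_of_nonneg_left ?_ h1
    have : (-2 * ϑ + ‖ξ‖ ^ 2) ^ 2 ≤ 2 * ‖ξ‖ ^ 4 + 8 * ϑ ^ 2 := by
      nlinarith [sq_nonneg (‖ξ‖ ^ 2 + 2 * ϑ)]
    have h5 := mul_le_mul_of_nonneg_left this hA.le
    have h6 : 0 ≤ (1 + 8 * ϑ ^ 2 * A) * ‖ξ‖ ^ 4 := by positivity
    rw [hB]
    linarith
  set H : EuclideanSpace ℝ (Fin 3) → ℝ := fun η => min 2 (‖η‖ ^ 2 / 2) / ‖η‖ ^ 4 with hH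
  have hHint : Integrable H := lks_H_int_s10
  have hdom : ∀ z : EuclideanSpace ℝ (Fin 3), z ≠ 0 → ∀ ξ,
      (1 - Real.cos ⟪ξ, z⟫) * S ξ ≤ K * ‖z‖ ^ 4 * H (‖z‖ • ξ) := by
    intro z hz ξ
    have hz' : 0 < ‖z‖ := norm_pos_iff.2 hz
    by_cases hξ : ξ = 0
    · subst hξ; simp [hH]
    have hξ' : 0 < ‖ξ‖ := norm_pos_iff.2 hξ
    have e : K * ‖z‖ ^ 4 * H (‖z‖ • ξ) = min 2 ((‖z‖ * ‖ξ‖) ^ 2 / 2) * (K / ‖ξ‖ ^ 4) := by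
      simp only [hH, norm_smul, norm_norm]
      field_simp
    rw [e]
    have hS1 : S ξ ≤ K / ‖ξ‖ ^ 4 := by
      rw [le_div_iff₀ (by positivity)]; exact hSup ξ
    have hc : 1 - Real.cos ⟪ξ, z⟫ ≤ min 2 ((‖z‖ * ‖ξ‖) ^ 2 / 2) := by
      apply le_min
      · linarith [Real.neg_one_le_cos ⟪ξ, z⟫]
      · have h1 := Real.one_sub_sq_div_two_le_cos (x := ⟪ξ, z⟫)
        have h2 : ⟪ξ, z⟫ ^ 2 ≤ (‖z‖ * ‖ξ‖) ^ 2 := by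
          rw [mul_comm]
          exact sq_le_sq' (neg_le_of_abs_le (abs_real_inner_le_norm ξ z)) (le_of_abs_le (abs_real_inner_le_norm ξ z))
        linarith
    exact mul_le_mul hc hS1 (hS0 ξ) (le_min (by norm_num) (by positivity))
  have hnn : ∀ z ξ : EuclideanSpace ℝ (Fin 3), 0 ≤ (1 - Real.cos ⟪ξ, z⟫) * S ξ := fun z ξ =>
    mul_nonneg (by linarith [Real.cos_le_one ⟪ξ, z⟫]) (hS0 ξ)
  have hHs : ∀ z : EuclideanSpace ℝ (Fin 3), z ≠ 0 →
      Integrable (fun ξ => K * ‖z‖ ^ 4 * H (‖z‖ • ξ)) := fun z hz =>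
    (hHint.comp_smul (norm_ne_zero_iff.2 hz)).const_mul _
  have hint : ∀ z : EuclideanSpace ℝ (Fin 3), z ≠ 0 →
      Integrable (fun ξ => (1 - Real.cos ⟪ξ, z⟫) * S ξ) := by
    intro z hz
    refine (hHs z hz).mono' ?_ ?_
    · apply Measurable.aestronglyMeasurable
      fun_prop
    · refine Filter.Eventually.of_forall fun ξ => ?_
      rw [Real.norm_of_nonneg (hnn z ξ)]
      exact hdom z hz ξ
  have hupper : ∀ z : EuclideanSpace ℝ (Fin 3), z ≠ 0 →
      (∫ ξ, (1 - Real.cos ⟪ξ, z⟫) * S ξ) ≤ (K * ∫ η, H η) * ‖z‖ := by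
    intro z hz
    have hz' : 0 < ‖z‖ := norm_pos_iff.2 hz
    refine (integral_mono (hint z hz) (hHs z hz) (hdom z hz)).trans (le_of_eq ?_)
    rw [integral_const_mul, Measure.integral_comp_smul]
    simp only [finrank_euclideanSpace, Fintype.card_fin, smul_eq_mul]
    rw [abs_of_pos (by positivity)]
    field_simp
  set V := volume.real (Metric.ball (0 : EuclideanSpace ℝ (Fin 3)) 1) with hV
  have hVpos : 0 < V :=
    ENNReal.toReal_pos (Metric.measure_ball_pos _ _ one_pos).ne' measure_ball_lt_top.ne
  set L := 4 * M with hL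
  set δ := 1 - Real.cos (1 / 2) with hδ
  have hδpos : 0 < δ := by
    have := Real.cos_lt_cos_of_nonneg_of_le_pi (x := 0) (y := 1 / 2) le_rfl
      (by linarith [Real.pi_gt_three]) (by norm_num)
    rw [Real.cos_zero] at this
    linarith
  set c := δ * (P * A / (B * (L ^ 4 + 6))) * (V / 8) with hc
  have hcpos : 0 < c := by positivity
  have hlower : ∀ z : EuclideanSpace ℝ (Fin 3), z ≠ 0 → ‖z‖ ≤ L →
      c * ‖z‖ ≤ ∫ ξ, (1 - Real.cos ⟪ξ, z⟫) * S ξ := by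
    intro z hz hzL
    have hz' : 0 < ‖z‖ := norm_pos_iff.2 hz
    set w := (‖z‖ ^ 2)⁻¹ • z with hw
    have hwn : ‖w‖ = ‖z‖⁻¹ := by
      rw [hw, norm_smul, Real.norm_of_nonneg (by positivity)]
      field_simp
    have hwz : ⟪w, z⟫ = 1 := by
      rw [hw, real_inner_smul_left, real_inner_self_eq_norm_sq]
      field_simp
    set r := (2 * ‖z‖)⁻¹ with hr
    have hrpos : 0 < r := by positivity
    set D := δ * (P * A / (B * (L ^ 4 + 6)) * ‖z‖ ^ 4) with hD
    have hpt : ∀ ξ ∈ Metric.ball w r, D ≤ (1 - Real.cos ⟪ξ, z⟫) * S ξ := by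
      intro ξ hξ
      rw [mem_ball_iff_norm] at hξ
      have h1 : |⟪ξ - w, z⟫| ≤ 1 / 2 := by
        refine (abs_real_inner_le_norm _ _).trans ?_
        have := mul_le_mul_of_nonneg_right hξ.le hz'.le
        refine this.trans (le_of_eq ?_)
        rw [hr]; field_simp
      rw [inner_sub_left, hwz, abs_le] at h1
      have h2 : Real.cos ⟪ξ, z⟫ ≤ Real.cos (1 / 2) :=
        Real.cos_le_cos_of_nonneg_of_le_pi (by norm_num)
          (by linarith [Real.pi_gt_three]) (by linarith)
      have h3 : ‖ξ‖ * ‖z‖ ≤ 3 / 2 := by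
        have h4 : ‖ξ‖ ≤ ‖ξ - w‖ + ‖w‖ := by simpa using norm_add_le (ξ - w) w
        have h5 : ‖ξ‖ ≤ r + ‖z‖⁻¹ := by linarith
        have := mul_le_mul_of_nonneg_right h5 hz'.le
        refine this.trans (le_of_eq ?_)
        rw [hr]; field_simp; norm_num
      have h6 : (1 + ‖ξ‖ ^ 4) * ‖z‖ ^ 4 ≤ L ^ 4 + 6 := by
        have a1 : ‖z‖ ^ 4 ≤ L ^ 4 := by gcongr
        have a2 : (‖ξ‖ * ‖z‖) ^ 4 ≤ (3 / 2) ^ 4 := by gcongr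
        rw [mul_pow] at a2
        norm_num at a2
        linarith
      have h7 : P * A / (B * (L ^ 4 + 6)) * ‖z‖ ^ 4 ≤ S ξ := by
        rw [div_mul_eq_mul_div, div_le_iff₀ (by positivity)]
        have b1 := mul_le_mul_of_nonneg_right (hSlow ξ) (by positivity : 0 ≤ ‖z‖ ^ 4)
        have b2 := mul_le_mul_of_nonneg_left h6 (mul_nonneg (hS0 ξ) hBpos.le)
        linarith
      exact mul_le_mul (by linarith) h7 (by positivity) (by linarith)
    calc c * ‖z‖ = ∫ ξ in Metric.ball w r, D := by
          rw [setIntegral_const, Measure.real, Measure.addHaar_ball _ _ hrpos.le,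
            ENNReal.toReal_mul, ENNReal.toReal_ofReal (by positivity)]
          change _ = (_ * V) • D
          simp only [finrank_euclideanSpace, Fintype.card_fin, smul_eq_mul]
          rw [hc, hD, hr]
          field_simp
          norm_num
      _ ≤ ∫ ξ in Metric.ball w r, (1 - Real.cos ⟪ξ, z⟫) * S ξ :=
          setIntegral_mono_on (integrableOn_const measure_ball_lt_top.ne)
            (hint z hz).integrableOn measurableSet_ball hpt
      _ ≤ ∫ ξ, (1 - Real.cos ⟪ξ, z⟫) * S ξ :=
          setIntegral_le_integral (hint z hz) (Filter.Eventually.of_forall (hnn z))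
  refine ⟨c, max c (K * ∫ η, H η), hcpos, le_max_left _ _, fun x y hx hy => ?_⟩
  by_cases hz : x - y = 0
  · simp [hz]
  have hzL : ‖x - y‖ ≤ L := by
    rw [EuclideanSpace.norm_eq]
    refine Real.sqrt_le_iff.2 ⟨by positivity, ?_⟩
    have hi : ∀ i, ‖(x - y) i‖ ^ 2 ≤ (2 * M) ^ 2 := fun i => by
      have h1 := hx i
      have h2 := hy i
      rw [Real.norm_eq_abs, sq_abs, PiLp.sub_apply]
      exact sq_le_sq' (by linarith [h1.1, h2.2]) (by linarith [h1.2, h2.1])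
    rw [Fin.sum_univ_three]
    nlinarith [hi 0, hi 1, hi 2, sq_nonneg M]
  refine ⟨hlower _ hz hzL, (hupper _ hz).trans ?_⟩
  gcongr
  exact le_max_right _ _
end

section
/- Fix ε > 0, ϑ ∈ ℝ and t > 0. There exists a finite constant C (depending on ε, ϑ, t) such that for all x, y ∈ ℝ² with 0 < |x−y| ≤ 1/2, ∫_{ℝ²} (1 − cos(⟨ξ, x−y⟩)) · (1 − exp(-(εt/4)·(-2ϑ+|ξ|²)²)) / (-2ϑ+|ξ|²)² dξ ≤ C · |x−y|² · log(1/|x−y|), where the integrand is extended by continuity at points with -2ϑ+|ξ|² = 0. -/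
open MeasureTheory Real
open scoped RealInnerProductSpace

lemma aux_int1 (s : ℝ) (hs : 0 < s) :
    ∫ y in Set.Ioi (0:ℝ), y * (1 + y ^ 2) ^ (-1 - s) = 1 / (2 * s) := by
  have hd : ∀ x ∈ Set.Ioi (0:ℝ), HasDerivAt (fun y : ℝ => -(1 / (2 * s)) * (1 + y ^ 2) ^ (-s))
      (x * (1 + x ^ 2) ^ (-1 - s)) x := by
    intro x _
    have h1 : HasDerivAt (fun y : ℝ => 1 + y ^ 2) (2 * x) x := by
      simpa using (hasDerivAt_pow 2 x).const_add 1
    have h2 := (h1.rpow_const (p := -s) (Or.inl (by positivity))).const_mul (-(1 / (2 * s)))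
    refine h2.congr_deriv ?_
    rw [show -s - 1 = -1 - s by ring]
    field_simp
  have hlim : Filter.Tendsto (fun y : ℝ => -(1 / (2 * s)) * (1 + y ^ 2) ^ (-s)) Filter.atTop
      (nhds 0) := by
    have h1 : Filter.Tendsto (fun y : ℝ => 1 + y ^ 2) Filter.atTop Filter.atTop :=
      Filter.tendsto_atTop_add_const_left _ _ (Filter.tendsto_pow_atTop (by norm_num))
    simpa using ((tendsto_rpow_neg_atTop hs).comp h1).const_mul (-(1 / (2 * s)))
  have hc : ContinuousWithinAt (fun y : ℝ => -(1 / (2 * s)) * (1 + y ^ 2) ^ (-s))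
      (Set.Ici 0) 0 := by
    apply ContinuousAt.continuousWithinAt
    apply ContinuousAt.mul continuousAt_const
    apply ContinuousAt.rpow_const (by fun_prop)
    left; norm_num
  rw [integral_Ioi_of_hasDerivAt_of_nonneg hc hd ?_ hlim]
  · simp
  · intro x hx
    have : (0:ℝ) < x := hx
    positivity

lemma aux_int2 (s : ℝ) (hs : 0 < s) :
    ∫ ξ : EuclideanSpace ℝ (Fin 2), (1 + ‖ξ‖ ^ 2) ^ (-1 - s) =
      2 * (volume.real (Metric.ball (0 : EuclideanSpace ℝ (Fin 2)) 1)) * (1 / (2 * s)) := by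
  have h := integral_fun_norm_addHaar (volume : Measure (EuclideanSpace ℝ (Fin 2)))
    (fun r : ℝ => (1 + r ^ 2) ^ (-1 - s))
  rw [h]
  simp only [finrank_euclideanSpace, Fintype.card_fin, smul_eq_mul, nsmul_eq_mul]
  norm_num
  rw [aux_int1 s hs]
  field_simp

lemma aux_intble (s : ℝ) (hs : 0 < s) :
    Integrable (fun ξ : EuclideanSpace ℝ (Fin 2) => (1 + ‖ξ‖ ^ 2) ^ (-1 - s)) := by
  have := integrable_rpow_neg_one_add_norm_sq (E := EuclideanSpace ℝ (Fin 2)) (μ := volume)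
    (r := 2 + 2 * s) (by simp; linarith)
  convert this using 3
  ring

lemma aux_cos_s11 (u p : ℝ) (hp0 : 0 ≤ p) (hp2 : p ≤ 2) : 1 - cos u ≤ 2 * |u| ^ p := by
  rcases le_total 1 |u| with h | h
  · have := Real.one_le_rpow h hp0
    linarith [neg_one_le_cos u]
  · have h1 := Real.one_sub_sq_div_two_le_cos (x := u)
    rcases eq_or_lt_of_le (abs_nonneg u) with h0 | h0
    · have : u = 0 := abs_eq_zero.mp h0.symm
      subst this
      have : (0:ℝ) ≤ |0| ^ p := by positivity
      simp only [cos_zero]; linarith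
    have h2 := Real.rpow_le_rpow_of_exponent_ge h0 h hp2
    have h3 : |u| ^ (2:ℝ) = u ^ 2 := by
      rw [Real.rpow_two, sq_abs]
    rw [h3] at h2
    linarith [sq_nonneg u]

lemma aux_w (b ϑ q : ℝ) (hb : 0 < b) :
    0 ≤ (if -2 * ϑ + q = 0 then b else (1 - Real.exp (-b * (-2 * ϑ + q) ^ 2)) /
                    (-2 * ϑ + q) ^ 2) ∧
    (if -2 * ϑ + q = 0 then b else (1 - Real.exp (-b * (-2 * ϑ + q) ^ 2)) /
                    (-2 * ϑ + q) ^ 2) * (1 + q) ^ 2 ≤ 2 + 2 * (1 + 2 * ϑ) ^ 2 * b := by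
  set a := -2 * ϑ + q with ha
  have hq : 1 + q = a + (1 + 2 * ϑ) := by rw [ha]; ring
  rw [hq]
  have hsq : (a + (1 + 2 * ϑ)) ^ 2 ≤ 2 * a ^ 2 + 2 * (1 + 2 * ϑ) ^ 2 := by
    nlinarith [sq_nonneg (a - (1 + 2 * ϑ))]
  split_ifs with h
  · refine ⟨hb.le, ?_⟩
    rw [h]
    nlinarith [mul_nonneg hb.le (sq_nonneg (1 + 2 * ϑ))]
  · have ha2 : 0 < a ^ 2 := by positivity
    have he : exp (-b * a ^ 2) ≤ 1 := Real.exp_le_one_iff.mpr (by nlinarith)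
    have he0 := Real.exp_pos (-b * a ^ 2)
    have he1 := Real.add_one_le_exp (-b * a ^ 2)
    have hw0 : 0 ≤ (1 - exp (-b * a ^ 2)) / a ^ 2 := div_nonneg (by linarith) ha2.le
    refine ⟨hw0, ?_⟩
    have hwb : (1 - exp (-b * a ^ 2)) / a ^ 2 ≤ b := by
      rw [div_le_iff₀ ha2]; linarith
    have hwa : (1 - exp (-b * a ^ 2)) / a ^ 2 * a ^ 2 ≤ 1 := by
      rw [div_mul_cancel₀ _ ha2.ne']; linarith
    have h1 := mul_le_mul_of_nonneg_left hsq hw0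
    have h2 := mul_le_mul_of_nonneg_right hwb (sq_nonneg (1 + 2 * ϑ))
    nlinarith

/-- Sharp upper bound for the squared L² spatial increments of the linear L-KS SPDE in
dimension `d = 2`: for `0 < |x−y| ≤ 1/2`,
`∫ (1 − cos⟨ξ, x−y⟩) (1 − e^{-(εt/4)(-2ϑ+|ξ|²)²})/(-2ϑ+|ξ|²)² dξ ≤ C |x−y|² log(1/|x−y|)`,
the integrand being extended by continuity (value `(1 − cos⟨ξ, x−y⟩)(εt/4)`) where
`-2ϑ+|ξ|² = 0`. -/
theorem lks_spatial_increment_upper_bound_dim2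
    (ε ϑ t : ℝ) (hε : 0 < ε) (ht : 0 < t) :
    ∃ C : ℝ, ∀ x y : EuclideanSpace ℝ (Fin 2),
      0 < ‖x - y‖ → ‖x - y‖ ≤ 1 / 2 →
        (∫ ξ : EuclideanSpace ℝ (Fin 2),
          (1 - Real.cos ⟪ξ, x - y⟫) *
            (if -2 * ϑ + ‖ξ‖ ^ 2 = 0 then ε * t / 4
             else (1 - Real.exp (-(ε * t / 4) * (-2 * ϑ + ‖ξ‖ ^ 2) ^ 2)) /
                    (-2 * ϑ + ‖ξ‖ ^ 2) ^ 2))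
          ≤ C * ‖x - y‖ ^ 2 * Real.log (1 / ‖x - y‖) := by
  set b := ε * t / 4 with hb
  have hb0 : 0 < b := by positivity
  set K := 2 + 2 * (1 + 2 * ϑ) ^ 2 * b with hK
  have hK0 : 0 < K := by positivity
  set V := volume.real (Metric.ball (0 : EuclideanSpace ℝ (Fin 2)) 1) with hV
  refine ⟨4 * exp 1 * K * V, ?_⟩
  intro x y h0 h1
  set z := x - y with hz
  set r := ‖z‖ with hr
  set L := Real.log (1 / r) with hL
  have hL2 : 1 / 2 < L := by
    have h2 : Real.log 2 ≤ L := by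
      apply Real.log_le_log (by norm_num)
      rw [le_div_iff₀ h0]; linarith
    linarith [Real.log_two_gt_d9]
  have hL0 : 0 < L := by linarith
  set s := 1 / (2 * L) with hs
  have hs0 : 0 < s := by positivity
  have hs1 : s ≤ 1 := by
    rw [hs, div_le_one (by positivity)]; linarith
  have hrp : r ^ (2 - 2 * s) = r ^ 2 * exp 1 := by
    have hlr : Real.log r = -L := by rw [hL, one_div, Real.log_inv]; ring
    rw [Real.rpow_sub h0, Real.rpow_two, Real.rpow_def_of_pos h0, hlr]
    have : -L * (2 * s) = -1 := by rw [hs]; field_simp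
    rw [this, Real.exp_neg]; field_simp
  have key : ∀ ξ : EuclideanSpace ℝ (Fin 2),
      (1 - Real.cos ⟪ξ, z⟫) *
            (if -2 * ϑ + ‖ξ‖ ^ 2 = 0 then b
             else (1 - Real.exp (-b * (-2 * ϑ + ‖ξ‖ ^ 2) ^ 2)) /
                    (-2 * ϑ + ‖ξ‖ ^ 2) ^ 2) ≤
        (2 * (r ^ 2 * exp 1) * K) * (1 + ‖ξ‖ ^ 2) ^ (-1 - s) := by
    intro ξ
    obtain ⟨w0, w1⟩ := aux_w b ϑ (‖ξ‖ ^ 2) hb0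
    set w := (if -2 * ϑ + ‖ξ‖ ^ 2 = 0 then b
             else (1 - Real.exp (-b * (-2 * ϑ + ‖ξ‖ ^ 2) ^ 2)) /
                    (-2 * ϑ + ‖ξ‖ ^ 2) ^ 2) with hw
    have hc := aux_cos_s11 ⟪ξ, z⟫ (2 - 2 * s) (by linarith) (by linarith)
    have hin : |⟪ξ, z⟫| ≤ ‖ξ‖ * r := abs_real_inner_le_norm ξ z
    have hpos : 0 < 1 + ‖ξ‖ ^ 2 := by positivity
    have hp1 : |⟪ξ, z⟫| ^ (2 - 2 * s) ≤ (1 + ‖ξ‖ ^ 2) ^ (1 - s) * (r ^ 2 * exp 1) := by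
      calc |⟪ξ, z⟫| ^ (2 - 2 * s) ≤ (‖ξ‖ * r) ^ (2 - 2 * s) :=
            Real.rpow_le_rpow (abs_nonneg _) hin (by linarith)
        _ = ‖ξ‖ ^ (2 - 2 * s) * r ^ (2 - 2 * s) := Real.mul_rpow (norm_nonneg _) h0.le
        _ = (‖ξ‖ ^ 2) ^ (1 - s) * (r ^ 2 * exp 1) := by
            rw [hrp, show 2 - 2 * s = 2 * (1 - s) by ring, Real.rpow_mul (norm_nonneg _),
              Real.rpow_two]
        _ ≤ _ := by
            apply mul_le_mul_of_nonneg_right _ (by positivity)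
            exact Real.rpow_le_rpow (by positivity) (by linarith) (by linarith)
    have hw2 : w ≤ K * (1 + ‖ξ‖ ^ 2) ^ (-2 : ℝ) := by
      rw [Real.rpow_neg hpos.le, Real.rpow_two, ← div_eq_mul_inv, le_div_iff₀ (by positivity)]
      exact w1
    have hsplit : (1 + ‖ξ‖ ^ 2) ^ (-1 - s) =
        (1 + ‖ξ‖ ^ 2) ^ (1 - s) * (1 + ‖ξ‖ ^ 2) ^ (-2 : ℝ) := by
      rw [← Real.rpow_add hpos]; congr 1; ring
    rw [hsplit]
    calc (1 - Real.cos ⟪ξ, z⟫) * w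
        ≤ (2 * ((1 + ‖ξ‖ ^ 2) ^ (1 - s) * (r ^ 2 * exp 1))) * (K * (1 + ‖ξ‖ ^ 2) ^ (-2 : ℝ)) := by
          apply mul_le_mul (by linarith) hw2 w0 (by positivity)
      _ = _ := by ring
  have hmono := integral_mono_of_nonneg (μ := (volume : Measure (EuclideanSpace ℝ (Fin 2))))
    (Filter.Eventually.of_forall fun ξ =>
      mul_nonneg (by linarith [Real.cos_le_one ⟪ξ, z⟫]) (aux_w b ϑ (‖ξ‖ ^ 2) hb0).1)
    ((aux_intble s hs0).const_mul (2 * (r ^ 2 * exp 1) * K))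
    (Filter.Eventually.of_forall key)
  refine hmono.trans (le_of_eq ?_)
  rw [integral_const_mul, aux_int2 s hs0, ← hV]
  have : 1 / (2 * s) = L := by rw [hs]; field_simp
  rw [this]; ring
end

section
/- Let β ∈ (0,1), t > 0 and c ∈ ℝ. Then ∫_0^t E_β(-c s^β)² ds = ∑_{k=0}^∞ (-c)^k · ( t^{βk+1} / (βk + 1) ) · a_k, where a_k = ∑_{j=0}^k 1 / ( Γ(1 + βj) · Γ(1 + β(k−j)) ), and the series converges absolutely. -/
open MeasureTheory Real

theorem gamma_lower_aux (M s : ℝ) (hM : 0 < M) (hs : 1 ≤ s) :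
    M ^ (s - 1) * Real.exp (-M) ≤ Real.Gamma s := by
  have hint := Real.GammaIntegral_convergent (s := s) (by linarith)
  rw [Real.Gamma_eq_integral (by linarith), ← integral_exp_neg_Ioi M, ← integral_const_mul]
  have hsub : Set.Ioi M ⊆ Set.Ioi (0 : ℝ) := Set.Ioi_subset_Ioi hM.le
  calc ∫ x in Set.Ioi M, M ^ (s - 1) * Real.exp (-x)
      ≤ ∫ x in Set.Ioi M, Real.exp (-x) * x ^ (s - 1) := by
        apply setIntegral_mono_on
        · exact (integrableOn_exp_neg_Ioi M).const_mul _
        · exact hint.mono_set hsub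
        · exact measurableSet_Ioi
        · intro x hx
          rw [mul_comm]
          gcongr
          exact le_of_lt hx
    _ ≤ ∫ x in Set.Ioi (0 : ℝ), Real.exp (-x) * x ^ (s - 1) := by
        apply setIntegral_mono_set hint
        · filter_upwards [ae_restrict_mem measurableSet_Ioi] with x hx
          have : (0 : ℝ) < x := hx
          simp only [Pi.zero_apply]
          positivity
        · exact hsub.eventuallyLE

theorem ml_summable_aux (β z : ℝ) (hβ : 0 < β) :
    Summable (fun k : ℕ => ‖z ^ k / Real.Gamma (1 + β * k)‖) := by
  set y : ℝ := |z| + 1 with hy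
  have hy0 : 0 < y := by positivity
  set M : ℝ := y ^ (1 / β) with hMdef
  have hM : 0 < M := by positivity
  have hg : Summable (fun k : ℕ => Real.exp M * (|z| / y) ^ k) := by
    apply Summable.mul_left
    apply summable_geometric_of_lt_one (by positivity)
    rw [div_lt_one hy0]; linarith
  refine Summable.of_nonneg_of_le (fun _ => norm_nonneg _) (fun k => ?_) hg
  have hk : 0 ≤ β * (k : ℝ) := by positivity
  have h1 := gamma_lower_aux M (1 + β * k) hM (by linarith)
  have h2 : M ^ (1 + β * (k : ℝ) - 1) = y ^ k := by
    rw [hMdef, ← Real.rpow_mul hy0.le, ← Real.rpow_natCast]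
    congr 1; field_simp; ring
  rw [h2] at h1
  have hG : 0 < Real.Gamma (1 + β * k) := Real.Gamma_pos_of_pos (by linarith)
  rw [norm_div, norm_pow, Real.norm_eq_abs, Real.norm_eq_abs, abs_of_pos hG]
  calc |z| ^ k / Real.Gamma (1 + β * k) ≤ |z| ^ k / (y ^ k * Real.exp (-M)) := by gcongr
    _ = Real.exp M * (|z| / y) ^ k := by
      rw [Real.exp_neg, div_pow]; field_simp

noncomputable def aCoef (β : ℝ) (k : ℕ) : ℝ :=
  ∑ j ∈ Finset.range (k + 1),
    1 / (Real.Gamma (1 + β * j) * Real.Gamma (1 + β * ((k : ℝ) - j)))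

theorem aCoef_nonneg (β : ℝ) (hβ : 0 < β) (k : ℕ) : 0 ≤ aCoef β k := by
  refine Finset.sum_nonneg fun j hj => ?_
  have hj' : j ≤ k := by simpa [Nat.lt_succ_iff] using hj
  have h : (0 : ℝ) ≤ (k : ℝ) - j := by
    have : (j : ℝ) ≤ k := by exact_mod_cast hj'
    linarith
  have h1 := Real.Gamma_pos_of_pos (show 0 < 1 + β * (j : ℝ) by positivity)
  have h2 := Real.Gamma_pos_of_pos (show 0 < 1 + β * ((k : ℝ) - j) by positivity)
  positivity

theorem aCoef_term (β z : ℝ) (k : ℕ) :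
    ∑ j ∈ Finset.range (k + 1), z ^ j / Real.Gamma (1 + β * j) *
      (z ^ (k - j) / Real.Gamma (1 + β * ((k - j : ℕ) : ℝ))) = z ^ k * aCoef β k := by
  rw [aCoef, Finset.mul_sum]
  refine Finset.sum_congr rfl fun j hj => ?_
  have hj' : j ≤ k := by simpa [Nat.lt_succ_iff] using hj
  rw [Nat.cast_sub hj', div_mul_div_comm, ← pow_add, Nat.add_sub_cancel' hj']
  ring

theorem aCoef_summable (β z : ℝ) (hβ : 0 < β) :
    Summable (fun k : ℕ => ‖z ^ k * aCoef β k‖) := by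
  have := summable_norm_sum_mul_range_of_summable_norm
    (ml_summable_aux β z hβ) (ml_summable_aux β z hβ)
  simpa only [aCoef_term] using this

theorem ml_sq_hasSum (β z : ℝ) (hβ : 0 < β) :
    HasSum (fun k : ℕ => z ^ k * aCoef β k) (mittagLeffler β z ^ 2) := by
  have := hasSum_sum_range_mul_of_summable_norm
    (ml_summable_aux β z hβ) (ml_summable_aux β z hβ)
  simp only [aCoef_term, ← pow_two] at this
  exact this

/-- Series expansion of the spatial spectral density of the `β`-time-fractional SPIDE:
`∫₀^t E_β(−c s^β)² ds = ∑ₖ (−c)ᵏ t^{βk+1}/(βk+1) · aₖ` with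
`aₖ = ∑_{j=0}^k 1/(Γ(1+βj)Γ(1+β(k−j)))`, the series converging absolutely. -/
theorem spide_spatial_spectral_density_series
    (β t c : ℝ) (hβ0 : 0 < β) (hβ1 : β < 1) (ht : 0 < t) :
    Summable (fun k : ℕ =>
      |(-c) ^ k * (t ^ (β * k + 1) / (β * k + 1)) *
        ∑ j ∈ Finset.range (k + 1),
          1 / (Real.Gamma (1 + β * j) * Real.Gamma (1 + β * ((k : ℝ) - j)))|) ∧
    (∫ s in (0 : ℝ)..t, (mittagLeffler β (-c * s ^ β)) ^ 2)
      = ∑' k : ℕ, (-c) ^ k * (t ^ (β * k + 1) / (β * k + 1)) *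
          ∑ j ∈ Finset.range (k + 1),
            1 / (Real.Gamma (1 + β * j) * Real.Gamma (1 + β * ((k : ℝ) - j))) := by
  have hterm : ∀ k : ℕ, (∫ s in (0 : ℝ)..t, (-c * s ^ β) ^ k * aCoef β k)
      = (-c) ^ k * (t ^ (β * k + 1) / (β * k + 1)) * aCoef β k := by
    intro k
    have hk : 0 ≤ β * (k : ℝ) := by positivity
    have : ∀ s ∈ Set.uIcc 0 t, (-c * s ^ β) ^ k * aCoef β k
        = ((-c) ^ k * aCoef β k) * s ^ (β * (k : ℝ)) := by
      intro s hs
      rw [Set.uIcc_of_le ht.le] at hs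
      rw [mul_pow, Real.rpow_mul_natCast hs.1]
      ring
    rw [intervalIntegral.integral_congr this, intervalIntegral.integral_const_mul,
      integral_rpow (Or.inl (by linarith)), Real.zero_rpow (by linarith)]
    ring
  have hbs := aCoef_summable β (|c| * t ^ β) hβ0
  have hsum : HasSum (fun k : ℕ => ∫ s in (0 : ℝ)..t, (-c * s ^ β) ^ k * aCoef β k)
      (∫ s in (0 : ℝ)..t, (mittagLeffler β (-c * s ^ β)) ^ 2) := by
    apply intervalIntegral.hasSum_integral_of_dominated_convergence
      (fun k _ => ‖(|c| * t ^ β) ^ k * aCoef β k‖)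
    · intro k
      apply Measurable.aestronglyMeasurable
      fun_prop
    · intro k
      refine Filter.Eventually.of_forall fun s hs => ?_
      rw [Set.uIoc_of_le ht.le] at hs
      have hs0 : 0 ≤ s := hs.1.le
      have hst := hs.2
      rw [norm_mul, norm_mul, norm_pow, norm_pow, norm_mul, norm_mul, norm_neg]
      simp only [Real.norm_eq_abs, abs_abs]
      rw [abs_of_nonneg (Real.rpow_nonneg hs0 β), abs_of_nonneg (Real.rpow_nonneg ht.le β)]
      gcongr
    · exact Filter.Eventually.of_forall fun s hs => hbs
    · simp
    · exact Filter.Eventually.of_forall fun s hs => ml_sq_hasSum β _ hβ0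
  simp only [hterm] at hsum
  refine ⟨?_, hsum.tsum_eq.symm⟩
  exact hsum.summable.abs
end
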